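/- arXiv:1503.03272 — 2 statements merged into one kernel-verified Lean document; each statement's English description precedes it below -/
import Mathlib

section
/- Let s₁, s₂ ≥ 2 be integers. Every non-complete graph G with σ₂(G) ≥ 2(s₁ + s₂ + 1) − 1 contains two vertex-disjoint induced subgraphs H₁ and H₂ such that σ₂(Hᵢ) ≥ 2sᵢ − 1 and |V(Hᵢ)| ≥ sᵢ + 1 for i = 1, 2. -/
/-- Degree of `u` within the induced subgraph on the vertex set `A`. -/
def degIn {V : Type*} [Fintype V] [DecidableEq V] (G : SimpleGraph V)
    [DecidableRel G.Adj] (A : Finset V) (u : V) : ℕ :=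
  (G.neighborFinset u ∩ A).card

section Partition

variable {V : Type*} [Fintype V] [DecidableEq V] (G : SimpleGraph V) [DecidableRel G.Adj]

lemma degIn_le_card (A : Finset V) (x : V) : degIn G A x ≤ A.card :=
  Finset.card_le_card Finset.inter_subset_right

lemma degIn_erase_self (A : Finset V) (x : V) : degIn G (A.erase x) x = degIn G A x := by
  unfold degIn
  congr 1
  ext y
  simp only [Finset.mem_inter, SimpleGraph.mem_neighborFinset, Finset.mem_erase]
  exact ⟨fun h => ⟨h.1, h.2.2⟩, fun h => ⟨h.1, h.1.ne', h.2⟩⟩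

lemma degIn_lt_card {A : Finset V} {x : V} (hx : x ∈ A) : degIn G A x < A.card := by
  rw [← degIn_erase_self]
  exact (degIn_le_card G _ x).trans_lt (Finset.card_erase_lt_of_mem hx)

lemma degIn_insert {A : Finset V} {x : V} (hx : x ∉ A) (y : V) :
    degIn G (insert x A) y = degIn G A y + if G.Adj y x then 1 else 0 := by
  unfold degIn
  split_ifs with h
  · rw [Finset.inter_insert_of_mem (by simpa using h), Finset.card_insert_of_notMem (by simp [hx])]
  · rw [Finset.inter_insert_of_notMem (by simpa using h), add_zero]

lemma degIn_le_degIn_erase (A : Finset V) (x y : V) :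
    degIn G A y ≤ degIn G (A.erase x) y + 1 := by
  by_cases hx : x ∈ A
  · conv_lhs => rw [← Finset.insert_erase hx]
    rw [degIn_insert G (Finset.notMem_erase x A)]
    split_ifs <;> omega
  · rw [Finset.erase_eq_of_notMem hx]
    omega

lemma degIn_add_degIn {A B : Finset V} (h : IsCompl A B) (x : V) :
    degIn G A x + degIn G B x = G.degree x := by
  unfold degIn
  rw [← Finset.card_union_of_disjoint
    (h.disjoint.mono Finset.inter_subset_right Finset.inter_subset_right),
    ← Finset.inter_union_distrib_left]
  have : A ∪ B = Finset.univ := h.sup_eq_top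
  rw [this, Finset.inter_univ, SimpleGraph.card_neighborFinset_eq_degree]

/-- `A` is not contained in `L`, and each of its vertices `x` has at least `c x` neighbours
in `A`. -/
def IsNice (L : Finset V) (c : V → ℤ) (A : Finset V) : Prop :=
  (∃ x ∈ A, x ∉ L) ∧ ∀ x ∈ A, c x ≤ degIn G A x

/-- No subset of `A` is nice for `c + 1`. -/
def IsDegen (L : Finset V) (c : V → ℤ) (A : Finset V) : Prop :=
  ∀ S ⊆ A, ¬ IsNice G L (fun x => c x + 1) S

/-- The potential of a set: twice its number of edges plus twice the sum of `c` over it. -/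
def potential (c : V → ℤ) (A : Finset V) : ℤ :=
  ∑ y ∈ A, ((degIn G A y : ℤ) + 2 * c y)

variable {G}

lemma IsNice.weaken {L : Finset V} {c : V → ℤ} {S : Finset V}
    (h : IsNice G L (fun x => c x + 1) S) : IsNice G L c S :=
  ⟨h.1, fun x hx => by have := h.2 x hx; dsimp only at this; omega⟩

lemma IsNice.erase {L : Finset V} {c : V → ℤ} (hc : ∀ x ∉ L, (L.card : ℤ) ≤ c x)
    {S : Finset V} (h : IsNice G L (fun x => c x + 1) S) (x : V) :
    IsNice G L c (S.erase x) := by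
  constructor
  · obtain ⟨z, hz, hzL⟩ := h.1
    have h1 := h.2 z hz
    have h2 := hc z hzL
    have h3 := degIn_lt_card G hz
    have h4 := Finset.pred_card_le_card_erase (s := S) (a := x)
    dsimp only at h1
    exact Finset.exists_mem_notMem_of_card_lt_card (by omega)
  · intro y hy
    have h1 := h.2 y (Finset.mem_of_mem_erase hy)
    have h2 := degIn_le_degIn_erase G S x y
    dsimp only at h1
    omega

lemma potential_insert (c : V → ℤ) {A : Finset V} {x : V} (hx : x ∉ A) :
    potential G c (insert x A) = potential G c A + 2 * degIn G A x + 2 * c x := by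
  unfold potential
  have hcount : ∑ y ∈ A, ((if G.Adj y x then 1 else 0 : ℕ) : ℤ) = degIn G A x := by
    rw [← Nat.cast_sum, Finset.sum_boole, Nat.cast_id]
    unfold degIn
    congr 2
    ext y
    simp [G.adj_comm, and_comm]
  rw [Finset.sum_insert hx, degIn_insert G hx x]
  simp only [degIn_insert G hx, SimpleGraph.irrefl, if_false, Nat.cast_add, Nat.cast_zero]
  rw [← hcount]
  simp only [Finset.sum_add_distrib]
  ring

/-- In a degenerate bipartition of maximal potential, moving a suitable vertex out of a part that
is not contained in `L` destroys the degeneracy of the other part. -/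
lemma exists_isNice_insert_of_maximal {L : Finset V} {a b : V → ℤ}
    (hd : ∀ x, a x + b x + 1 ≤ G.degree x) {A B : Finset V} (hAB : IsCompl A B)
    (hA : IsDegen G L a A) (hAL : ∃ x ∈ A, x ∉ L)
    (hmax : ∀ A' B', IsCompl A' B' → IsDegen G L a A' → IsDegen G L b B' →
      potential G b A' + potential G a B' ≤ potential G b A + potential G a B) :
    ∃ x, ∃ S ⊆ insert x B, IsNice G L (fun x => b x + 1) S := by
  have h1 := hA A subset_rfl
  simp only [IsNice, hAL, true_and, not_forall, not_le] at h1
  obtain ⟨x, hx, hlt⟩ := h1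
  refine ⟨x, ?_⟩
  by_contra hS
  have hxB : x ∉ B := Finset.disjoint_left.1 hAB.disjoint hx
  have hcompl : IsCompl (A.erase x) (insert x B) := by
    have : B = Aᶜ := hAB.compl_eq.symm
    rw [this, ← Finset.compl_erase]
    exact isCompl_compl
  have h2 := hmax _ _ hcompl (fun S hSA => hA S (hSA.trans (Finset.erase_subset x A)))
    (fun S hSB hn => hS ⟨S, hSB, hn⟩)
  have h3 := potential_insert (G := G) b (Finset.notMem_erase x A)
  rw [Finset.insert_erase hx, degIn_erase_self] at h3
  have h4 := potential_insert (G := G) a hxB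
  have h5 := degIn_add_degIn G hAB x
  have h6 := hd x
  omega

lemma exists_isDegen_bipartition {L : Finset V} {a b : V → ℤ}
    (ha : ∀ x ∉ L, (L.card : ℤ) ≤ a x)
    (hno : ¬ ∃ A B, Disjoint A B ∧ IsNice G L a A ∧ IsNice G L b B) :
    ∃ A B, IsCompl A B ∧ IsDegen G L a A ∧ IsDegen G L b B := by
  by_cases hex : ∃ A, IsNice G L a A
  · obtain ⟨A, hA⟩ := exists_minimal_of_wellFoundedLT _ hex
    refine ⟨A, Aᶜ, isCompl_compl, fun S hS hn => ?_, fun S hS hn => ?_⟩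
    · obtain ⟨x, hx, -⟩ := hn.1
      have := hA.2 (hn.erase ha x) ((Finset.erase_subset x S).trans hS) (hS hx)
      exact Finset.notMem_erase x S this
    · exact hno ⟨A, S, disjoint_compl_right.mono_right hS, hA.1, hn.weaken⟩
  · refine ⟨⊤, ⊥, isCompl_top_bot, fun S _ hn => hex ⟨S, hn.weaken⟩, fun S hS hn => ?_⟩
    obtain ⟨x, hx, -⟩ := hn.1
    exact absurd (hS hx) (Finset.notMem_empty x)

/-- A variant of Stiebitz's theorem on decompositions under degree constraints, in which the
constraints may be negative on a small exceptional set `L` and both parts have to leave `L`. -/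
theorem exists_disjoint_isNice {L : Finset V} {a b : V → ℤ}
    (hd : ∀ x, a x + b x + 1 ≤ G.degree x) (hL : ∃ x, x ∉ L)
    (ha : ∀ x ∉ L, (L.card : ℤ) ≤ a x) (hb : ∀ x ∉ L, (L.card : ℤ) ≤ b x) :
    ∃ A B, Disjoint A B ∧ IsNice G L a A ∧ IsNice G L b B := by
  by_contra hno
  obtain ⟨A₀, B₀, h₀⟩ := exists_isDegen_bipartition ha hno
  obtain ⟨⟨A, B⟩, ⟨hAB, hA, hB⟩, hmax⟩ := Set.exists_max_image
    {p : Finset V × Finset V | IsCompl p.1 p.2 ∧ IsDegen G L a p.1 ∧ IsDegen G L b p.2}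
    (fun p => potential G b p.1 + potential G a p.2) (Set.toFinite _) ⟨(A₀, B₀), h₀⟩
  dsimp only at hAB hA hB
  have fromA (hAL : ∃ x ∈ A, x ∉ L) : ∃ S ⊆ B, IsNice G L b S := by
    obtain ⟨x, S, hS, hn⟩ := exists_isNice_insert_of_maximal hd hAB hA hAL
      (fun A' B' h h' h'' => hmax (A', B') ⟨h, h', h''⟩)
    exact ⟨S.erase x, Finset.subset_insert_iff.1 hS, hn.erase hb x⟩
  have fromB (hBL : ∃ x ∈ B, x ∉ L) : ∃ S ⊆ A, IsNice G L a S := by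
    obtain ⟨x, S, hS, hn⟩ := exists_isNice_insert_of_maximal (a := b) (b := a)
      (fun x => by have := hd x; omega) hAB.symm hB hBL
      (fun A' B' h h' h'' => by
        have := hmax (B', A') ⟨h.symm, h'', h'⟩
        dsimp only at this
        omega)
    exact ⟨S.erase x, Finset.subset_insert_iff.1 hS, hn.erase ha x⟩
  have outside {S T : Finset V} (hST : S ⊆ T) {c : V → ℤ} (hn : IsNice G L c S) :
      ∃ x ∈ T, x ∉ L := by
    obtain ⟨x, hx, hxL⟩ := hn.1
    exact ⟨x, hST hx, hxL⟩
  have hAL : ∃ x ∈ A, x ∉ L := by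
    obtain ⟨x, hxL⟩ := hL
    have hx : x ∈ A ∪ B := by
      have : A ∪ B = Finset.univ := hAB.sup_eq_top
      simp [this]
    rcases Finset.mem_union.1 hx with hx | hx
    · exact ⟨x, hx, hxL⟩
    · obtain ⟨S, hS, hn⟩ := fromB ⟨x, hx, hxL⟩
      exact outside hS hn
  obtain ⟨S, hS, hSn⟩ := fromA hAL
  obtain ⟨T, hT, hTn⟩ := fromB (outside hS hSn)
  exact hno ⟨T, S, hAB.disjoint.mono hT hS, hTn, hSn⟩

/-- Deleting a set of `s + 1` vertices lowers every degree sum by at most `2 * (s + 1)`. -/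
lemma degIn_compl_add_degIn_compl {s t : ℕ}
    (hσ : ∀ u v : V, u ≠ v → ¬G.Adj u v →
      2 * (s + t + 1) - 1 ≤ G.degree u + G.degree v)
    {K : Finset V} (hK : K.card = s + 1) (u v : V) (huv : u ≠ v) (hadj : ¬G.Adj u v) :
    2 * t - 1 ≤ degIn G Kᶜ u + degIn G Kᶜ v := by
  have h1 := hσ u v huv hadj
  have h2 := degIn_add_degIn G (isCompl_compl (x := K)) u
  have h3 := degIn_add_degIn G (isCompl_compl (x := K)) v
  have h4 := degIn_le_card G K u
  have h5 := degIn_le_card G K v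
  omega

end Partition

theorem stmt_5 {V : Type*} [Fintype V] [DecidableEq V]
    (G : SimpleGraph V) [DecidableRel G.Adj] (s₁ s₂ : ℕ) (hs₁ : 2 ≤ s₁) (hs₂ : 2 ≤ s₂)
    (hnc : ∃ u v : V, u ≠ v ∧ ¬G.Adj u v)
    (hσ : ∀ u v : V, u ≠ v → ¬G.Adj u v →
      2 * (s₁ + s₂ + 1) - 1 ≤ G.degree u + G.degree v) :
    ∃ A₁ A₂ : Finset V, Disjoint A₁ A₂ ∧
      (∀ u ∈ A₁, ∀ v ∈ A₁, u ≠ v → ¬G.Adj u v →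
        2 * s₁ - 1 ≤ degIn G A₁ u + degIn G A₁ v) ∧ s₁ + 1 ≤ A₁.card ∧
      (∀ u ∈ A₂, ∀ v ∈ A₂, u ≠ v → ¬G.Adj u v →
        2 * s₂ - 1 ≤ degIn G A₂ u + degIn G A₂ v) ∧ s₂ + 1 ≤ A₂.card := by
  obtain ⟨w, hw⟩ : ∃ w, s₁ + s₂ + 1 ≤ G.degree w := by
    obtain ⟨u, v, huv, hadj⟩ := hnc
    have := hσ u v huv hadj
    by_cases h : s₁ + s₂ + 1 ≤ G.degree u
    · exact ⟨u, h⟩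
    · exact ⟨v, by omega⟩
  have hV : s₁ + s₂ + 2 ≤ Fintype.card V := by
    have := G.degree_lt_card_verts w
    omega
  let L : Finset V := {x | G.degree x ≤ s₁ + s₂}
  have hclique : ∀ u ∈ L, ∀ v ∈ L, u ≠ v → G.Adj u v := by
    intro u hu v hv huv
    by_contra hadj
    have := hσ u v huv hadj
    simp only [L, Finset.mem_filter, Finset.mem_univ, true_and] at hu hv
    omega
  have hnotL : ∀ x ∉ L, s₁ + s₂ + 1 ≤ G.degree x := by
    intro x hx
    simp only [L, Finset.mem_filter, Finset.mem_univ, true_and] at hx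
    omega
  by_cases hL₁ : s₁ + 1 ≤ L.card
  · obtain ⟨K, hKL, hK⟩ := Finset.exists_subset_card_eq hL₁
    refine ⟨K, Kᶜ, disjoint_compl_right,
      fun u hu v hv huv hadj => absurd (hclique u (hKL hu) v (hKL hv) huv) hadj, hK.ge,
      fun u _ v _ => degIn_compl_add_degIn_compl hσ hK u v, ?_⟩
    rw [Finset.card_compl]
    omega
  by_cases hL₂ : s₂ + 1 ≤ L.card
  · obtain ⟨K, hKL, hK⟩ := Finset.exists_subset_card_eq hL₂
    refine ⟨Kᶜ, K, disjoint_compl_left,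
      fun u _ v _ => degIn_compl_add_degIn_compl (by simpa only [add_comm s₂ s₁] using hσ) hK u v,
      ?_,
      fun u hu v hv huv hadj => absurd (hclique u (hKL hu) v (hKL hv) huv) hadj, hK.ge⟩
    rw [Finset.card_compl]
    omega
  obtain ⟨A, B, hAB, hA, hB⟩ := exists_disjoint_isNice (G := G) (L := L)
    (a := fun _ => (s₁ : ℤ)) (b := fun x => (G.degree x : ℤ) - s₁ - 1)
    (fun x => by omega) ⟨w, by simp only [L, Finset.mem_filter]; omega⟩
    (fun x _ => by omega) (fun x hx => by have := hnotL x hx; omega)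
  refine ⟨A, B, hAB, fun u hu v hv _ _ => ?_, ?_, fun u hu v hv huv hadj => ?_, ?_⟩
  · have h1 := hA.2 u hu
    have h2 := hA.2 v hv
    dsimp only at h1 h2
    omega
  · obtain ⟨x, hx, -⟩ := hA.1
    have h1 := hA.2 x hx
    have h2 := degIn_lt_card G hx
    dsimp only at h1
    omega
  · have h1 := hB.2 u hu
    have h2 := hB.2 v hv
    have h3 := hσ u v huv hadj
    dsimp only at h1 h2
    omega
  · obtain ⟨x, hx, hxL⟩ := hB.1
    have h1 := hB.2 x hx
    have h2 := degIn_lt_card G hx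
    have h3 := hnotL x hxL
    dsimp only at h1
    omega
end

section
/- Every graph G of order at least 3 with σ₂(G) ≥ 5 contains a cycle whose length is divisible by 3. -/
namespace SimpleGraph

variable {V : Type*} {G : SimpleGraph V} {ω : Sym2 V → ℕ}

/-- The total weight of the edges of a walk. -/
def Walk.weight (ω : Sym2 V → ℕ) {u v : V} (p : G.Walk u v) : ℕ := (p.edges.map ω).sum

@[simp] lemma Walk.weight_nil {u : V} : (Walk.nil : G.Walk u u).weight ω = 0 := rfl

@[simp] lemma Walk.weight_cons {u v w : V} (h : G.Adj u v) (p : G.Walk v w) :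
    (Walk.cons h p).weight ω = ω s(u, v) + p.weight ω := by simp [weight]

@[simp] lemma Walk.weight_append {u v w : V} (p : G.Walk u v) (q : G.Walk v w) :
    (p.append q).weight ω = p.weight ω + q.weight ω := by simp [weight]

@[simp] lemma Walk.weight_reverse {u v : V} (p : G.Walk u v) :
    p.reverse.weight ω = p.weight ω := by simp [weight]

lemma Walk.weight_eq_length {u v : V} (p : G.Walk u v) (h : ∀ e ∈ p.edges, ω e = 1) :
    p.weight ω = p.length := by
  rw [weight, List.map_congr_left h]
  simp

/-- The edges of `G` with both ends in `A`. -/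
def restrict (G : SimpleGraph V) (A : Set V) : SimpleGraph V where
  Adj u v := G.Adj u v ∧ u ∈ A ∧ v ∈ A
  symm := ⟨fun _ _ h => ⟨h.1.symm, h.2.2, h.2.1⟩⟩
  loopless := ⟨fun _ h => h.1.ne rfl⟩

lemma restrict_le (A : Set V) : G.restrict A ≤ G := fun _ _ h => h.1

lemma restrict_mono {A B : Set V} (h : A ⊆ B) : G.restrict A ≤ G.restrict B :=
  fun _ _ h' => ⟨h'.1, h h'.2.1, h h'.2.2⟩

/-- There is a path from `u` to `v` inside `Q`, of length at least `n` and weight `k`. -/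
def HasPath (G : SimpleGraph V) (ω : Sym2 V → ℕ) (Q : Set V) (n : ℕ) (u v : V) (k : ℕ) : Prop :=
  ∃ p : G.Walk u v, p.IsPath ∧ (∀ z ∈ p.support, z ∈ Q) ∧ n ≤ p.length ∧ p.weight ω = k

/-- No cycle of `G` has weight divisible by three. -/
def NoCycleModThree (G : SimpleGraph V) (ω : Sym2 V → ℕ) : Prop :=
  ∀ (v : V) (w : G.Walk v v), w.IsCycle → ¬ 3 ∣ w.weight ω

namespace HasPath

variable {Q Q₁ Q₂ : Set V} {m n k l : ℕ} {u v w : V}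

lemma refl (h : u ∈ Q) : G.HasPath ω Q 0 u u 0 :=
  ⟨.nil, by simp, by simpa using h, by simp, by simp⟩

lemma mono (h : G.HasPath ω Q₁ n u v k) (hQ : Q₁ ⊆ Q₂) (hmn : m ≤ n) :
    G.HasPath ω Q₂ m u v k := by
  obtain ⟨p, hp, hs, hn, hk⟩ := h
  exact ⟨p, hp, fun z hz => hQ (hs z hz), hmn.trans hn, hk⟩

lemma cons (h : G.HasPath ω Q n v w k) (ha : G.Adj u v) (hu : u ∉ Q) :
    G.HasPath ω (insert u Q) (n + 1) u w (ω s(u, v) + k) := by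
  obtain ⟨p, hp, hs, hn, hk⟩ := h
  refine ⟨.cons ha p, hp.cons fun h => hu (hs u h), ?_, by simpa using hn, by simp [hk]⟩
  simp only [Walk.support_cons, List.mem_cons, Set.mem_insert_iff]
  rintro z (rfl | hz)
  · exact .inl rfl
  · exact .inr (hs z hz)

lemma symm (h : G.HasPath ω Q n u v k) : G.HasPath ω Q n v u k := by
  obtain ⟨p, hp, hs, hn, hk⟩ := h
  exact ⟨p.reverse, hp.reverse, by simpa using hs, by simpa using hn, by simpa using hk⟩

lemma trans (h₁ : G.HasPath ω Q₁ m u v k) (h₂ : G.HasPath ω Q₂ n v w l)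
    (hQ : ∀ z ∈ Q₁, z ∈ Q₂ → z = v) : G.HasPath ω (Q₁ ∪ Q₂) (m + n) u w (k + l) := by
  obtain ⟨p, hp, hs, hn, hk⟩ := h₁
  obtain ⟨q, hq, hs', hn', hk'⟩ := h₂
  refine ⟨p.append q, ?_, ?_, by simp; omega, by simp [hk, hk']⟩
  · rw [Walk.isPath_def, Walk.support_append, List.nodup_append']
    refine ⟨hp.support_nodup, hq.support_nodup.tail, fun z hz hz' => ?_⟩
    have hv : z = v := hQ z (hs z hz) (hs' z (List.mem_of_mem_tail hz'))
    have := hq.support_nodup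
    rw [← Walk.cons_tail_support, List.nodup_cons] at this
    exact this.1 (hv ▸ hz')
  · intro z hz
    rw [Walk.mem_support_append_iff] at hz
    exact hz.imp (hs z) (hs' z)

lemma not_dvd (hG : G.NoCycleModThree ω) (h₁ : G.HasPath ω Q₁ m u v k)
    (h₂ : G.HasPath ω Q₂ n v u l) (hQ : ∀ z ∈ Q₁, z ∈ Q₂ → z = u ∨ z = v)
    (hm : 1 < m ∨ 1 < n) : ¬ 3 ∣ k + l := by
  obtain ⟨p, hp, hs, hn, hk⟩ := h₁
  obtain ⟨q, hq, hs', hn', hk'⟩ := h₂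
  have hc : (p.append q).IsCycle := by
    refine hp.isCycle_append hq (fun z hz hz' => ?_) (by omega)
    have hp' := hp.support_nodup
    have hq' := hq.support_nodup
    rw [← Walk.cons_tail_support, List.nodup_cons] at hp' hq'
    rcases hQ z (hs z (List.mem_of_mem_tail hz)) (hs' z (List.mem_of_mem_tail hz')) with h | h
    · exact hp'.1 (h ▸ hz)
    · exact hq'.1 (h ▸ hz')
  simpa [hk, hk'] using hG _ _ hc

end HasPath

open Relation in
/-- A connected set has a rooted spanning tree; `D` is the weighted depth and `m x y` is the depth
of the lowest common ancestor of `x` and `y`. -/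
lemma exists_tree_depth (hω : ∀ e, 1 ≤ ω e) {K : Set V} {c : V}
    (hK : ∀ x ∈ K, (G.restrict K).Reachable c x) :
    ∃ (D : V → ℕ) (m : V → V → ℕ), (∀ x y, m x y = m y x) ∧
      (∀ x ∈ K, ∀ y ∈ K, ∀ z ∈ K, min (m x y) (m y z) ≤ m x z) ∧
      ∀ x ∈ K, ∀ y ∈ K, ∃ k, k + 2 * m x y = D x + D y ∧
        G.HasPath ω {z | z ∈ K ∧ m x y ≤ D z ∧ (m x z = D z ∨ m y z = D z)} 0 x y k := by
  classical
  let D : V → ℕ := fun v => sInf {k | ∃ w : (G.restrict K).Walk v c, w.weight ω = k}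
  have hD : ∀ v (w : (G.restrict K).Walk v c), D v ≤ w.weight ω :=
    fun v w => Nat.sInf_le ⟨w, rfl⟩
  have hpar : ∀ v ∈ K, v ≠ c → ∃ u ∈ K, G.Adj v u ∧ D v = ω s(v, u) + D u := by
    intro v hv hvc
    have hne : {k | ∃ w : (G.restrict K).Walk v c, w.weight ω = k}.Nonempty :=
      ⟨_, (hK v hv).some.reverse, rfl⟩
    obtain ⟨w, hw⟩ : ∃ w : (G.restrict K).Walk v c, w.weight ω = D v := Nat.sInf_mem hne
    cases w with
    | nil => exact absurd rfl hvc
    | @cons _ u _ h p =>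
      refine ⟨u, h.2.2, h.1, ?_⟩
      obtain ⟨q, hq⟩ : ∃ w : (G.restrict K).Walk u c, w.weight ω = D u :=
        Nat.sInf_mem (s := {k | ∃ w : (G.restrict K).Walk u c, w.weight ω = k}) ⟨_, p, rfl⟩
      have h₁ := hD v (.cons h q)
      have h₂ := hD u p
      rw [Walk.weight_cons] at h₁ hw
      omega
  choose! par hparK hparA hparD using hpar
  let R : V → V → Prop := fun v u => v ∈ K ∧ v ≠ c ∧ u = par v
  let A : V → V → Prop := ReflTransGen R
  have hstep : ∀ v u, R v u → D u < D v := by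
    rintro v u ⟨h₁, h₂, rfl⟩
    have := hparD v h₁ h₂
    have := hω s(v, par v)
    omega
  have hAK : ∀ x z, A x z → x ∈ K → z ∈ K := by
    intro x z h hx
    induction h with
    | refl => exact hx
    | tail _ h _ => obtain ⟨h₁, h₂, rfl⟩ := h; exact hparK _ h₁ h₂
  have hAD : ∀ x z, A x z → D z ≤ D x := by
    intro x z h
    induction h with
    | refl => exact le_rfl
    | tail _ h ih => exact (hstep _ _ h).le.trans ih
  have hAeq : ∀ x z, A x z → D x ≤ D z → x = z := by
    intro x z h hd
    rcases ReflTransGen.cases_head h with h | ⟨u, hu, h⟩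
    · exact h
    · have := hstep _ _ hu
      have := hAD _ _ h
      omega
  have hchain : ∀ x z z', A x z → A x z' → A z z' ∨ A z' z := fun x z z' h h' =>
    ReflTransGen.total_of_right_unique (fun _ _ _ h₁ h₂ => h₁.2.2.trans h₂.2.2.symm) h h'
  have hroot : ∀ n, ∀ x ∈ K, D x ≤ n → A x c := by
    intro n
    induction n with
    | zero =>
      intro x hx hn
      by_cases hxc : x = c
      · exact hxc ▸ .refl
      · have := hstep x _ ⟨hx, hxc, rfl⟩
        omega
    | succ n ih =>
      intro x hx hn
      by_cases hxc : x = c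
      · exact hxc ▸ .refl
      · have h := hstep x _ ⟨hx, hxc, rfl⟩
        exact .head ⟨hx, hxc, rfl⟩ (ih _ (hparK x hx hxc) (by omega))
  have hup : ∀ x z, A x z → ∃ k, k + D z = D x ∧ G.HasPath ω {u | A x u ∧ D z ≤ D u} 0 x z k := by
    intro x z h
    induction h using ReflTransGen.head_induction_on with
    | refl => exact ⟨0, by simp, .refl ⟨.refl, le_rfl⟩⟩
    | @head x y hxy hyz ih =>
      obtain ⟨k, hk, hp⟩ := ih
      obtain ⟨h₁, h₂, rfl⟩ := hxy
      have hlt := hstep x _ ⟨h₁, h₂, rfl⟩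
      refine ⟨ω s(x, par x) + k, by rw [hparD x h₁ h₂]; omega, ?_⟩
      refine (hp.cons (hparA x h₁ h₂) ?_).mono ?_ (Nat.zero_le _)
      · rintro ⟨h, -⟩
        have := hAD _ _ h
        omega
      · rintro u (rfl | ⟨hu, hu'⟩)
        · exact ⟨.refl, (hAD _ _ hyz).trans hlt.le⟩
        · exact ⟨.head ⟨h₁, h₂, rfl⟩ hu, hu'⟩
  let m : V → V → ℕ := fun x y => sSup {d | ∃ z, A x z ∧ A y z ∧ D z = d}
  have hbdd : ∀ x y, BddAbove {d | ∃ z, A x z ∧ A y z ∧ D z = d} := by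
    rintro x y
    refine ⟨D x, ?_⟩
    rintro _ ⟨z, hz, -, rfl⟩
    exact hAD _ _ hz
  have hm_le : ∀ x y z, A x z → A y z → D z ≤ m x y := fun x y z h h' =>
    le_csSup (hbdd x y) ⟨z, h, h', rfl⟩
  have hm_mem : ∀ x ∈ K, ∀ y ∈ K, ∃ z, A x z ∧ A y z ∧ D z = m x y := fun x hx y hy =>
    Nat.sSup_mem (s := {d | ∃ z, A x z ∧ A y z ∧ D z = d})
      ⟨_, c, hroot _ x hx le_rfl, hroot _ y hy le_rfl, rfl⟩ (hbdd x y)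
  have hm_anc : ∀ x z, A x z → m x z = D z := by
    intro x z h
    refine le_antisymm (csSup_le ⟨_, z, h, .refl, rfl⟩ ?_) (hm_le x z z h .refl)
    rintro _ ⟨u, -, hu, rfl⟩
    exact hAD _ _ hu
  refine ⟨D, m, fun x y => ?_, fun x hx y hy z hz => ?_, fun x hx y hy => ?_⟩
  · simp only [m]
    congr 1
    ext d
    exact exists_congr fun z => by tauto
  · obtain ⟨p, hp₁, hp₂, hp⟩ := hm_mem x hx y hy
    obtain ⟨q, hq₁, hq₂, hq⟩ := hm_mem y hy z hz
    rcases hchain _ _ _ hp₂ hq₁ with h | h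
    · exact (min_le_right _ _).trans (hq ▸ hm_le x z q (hp₁.trans h) hq₂)
    · exact (min_le_left _ _).trans (hp ▸ hm_le x z p hp₁ (hq₂.trans h))
  · obtain ⟨z, hxz, hyz, hz⟩ := hm_mem x hx y hy
    obtain ⟨k, hk, hp⟩ := hup x z hxz
    obtain ⟨l, hl, hq⟩ := hup y z hyz
    refine ⟨k + l, by omega, (hp.trans hq.symm ?_).mono ?_ le_rfl⟩
    · rintro u ⟨hu, hu'⟩ ⟨hv, -⟩
      have h₁ := hm_le x y u hu hv
      rcases hchain x u z hu hxz with h | h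
      · exact hAeq _ _ h (by omega)
      · exact (hAeq _ _ h (by omega)).symm
    · rintro u (⟨hu, hu'⟩ | ⟨hu, hu'⟩)
      · exact ⟨hAK _ _ hu hx, hz ▸ hu', .inl (hm_anc _ _ hu)⟩
      · exact ⟨hAK _ _ hu hy, hz ▸ hu', .inr (hm_anc _ _ hu)⟩

lemma hasPath_segment {w : ℕ → V} {N : ℕ} (hinj : Set.InjOn w (Set.Iic N))
    (hw : ∀ i < N, G.Adj (w i) (w (i + 1))) (hw1 : ∀ i < N, ω s(w i, w (i + 1)) = 1)
    {i j : ℕ} (hij : i ≤ j) (hj : j ≤ N) :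
    G.HasPath ω {z | ∃ k, i ≤ k ∧ k ≤ j ∧ w k = z} (j - i) (w i) (w j) (j - i) := by
  induction hij using Nat.decreasingInduction with
  | self =>
    rw [Nat.sub_self]
    exact HasPath.refl ⟨j, le_rfl, le_rfl, rfl⟩
  | of_succ i hi ih =>
    have h := ih.cons (hw i (by omega)) ?_
    · rw [hw1 i (by omega)] at h
      rw [show j - i = 1 + (j - (i + 1)) by omega]
      refine h.mono ?_ (by omega)
      rintro z (rfl | ⟨k, h₁, h₂, rfl⟩)
      · exact ⟨i, le_rfl, by omega, rfl⟩
      · exact ⟨k, by omega, h₂, rfl⟩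
    · rintro ⟨k, h₁, h₂, h₃⟩
      have := hinj (by simp; omega) (by simp; omega) h₃
      omega

/-- The four-point condition for an ultrametric. -/
lemma four_point {a b c d e f : ℕ}
    (h₁ : min a b ≤ d) (h₂ : min a d ≤ b) (h₃ : min b d ≤ a)
    (h₄ : min a c ≤ e) (h₅ : min a e ≤ c) (h₆ : min c e ≤ a)
    (h₇ : min b c ≤ f) (h₈ : min b f ≤ c) (h₉ : min c f ≤ b)
    (h₁₀ : min d e ≤ f) (h₁₁ : min d f ≤ e) (h₁₂ : min e f ≤ d) :
    (a + f = b + e ∧ a + f ≤ c + d) ∨ (a + f = c + d ∧ a + f ≤ b + e) ∨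
      (b + e = c + d ∧ b + e ≤ a + f) := by
  grind

/-- A cycle `w 0, …, w N` of length at least four, all of whose edges except possibly the closing
one have weight one, cannot be completely attached to a connected set. -/
lemma not_noCycleModThree_of_attached (hω : ∀ e, 1 ≤ ω e) (hG : G.NoCycleModThree ω)
    {K : Set V} {c : V} (hK : ∀ x ∈ K, (G.restrict K).Reachable c x)
    {w : ℕ → V} {N : ℕ} (hinj : Set.InjOn w (Set.Iic N))
    (hw : ∀ i < N, G.Adj (w i) (w (i + 1))) (hw1 : ∀ i < N, ω s(w i, w (i + 1)) = 1)
    (hN : 4 ≤ N) (hcl : G.Adj (w N) (w 0)) (hc : (N + ω s(w N, w 0)) % 3 = 1 → 5 ≤ N)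
    (hwK : ∀ i ≤ N, w i ∉ K) (hnb : ∀ i ≤ N, ∃ x ∈ K, G.Adj (w i) x) : False := by
  obtain ⟨D, m, hsymm, hum, hpath⟩ := exists_tree_depth hω hK
  have : Nonempty V := ⟨c⟩
  choose! x hxK hx using hnb
  set t := ω s(w N, w 0) with ht
  have hne : ∀ i j, i ≤ N → j ≤ N → i ≠ j → w i ≠ w j := fun i j hi hj hij h => hij (hinj hi hj h)
  have hatt : ∀ i j, i ≤ N → j ≤ N → ∃ k, i ≠ j →
      k + 2 * m (x i) (x j) = (D (x i) + ω s(w i, x i)) + (D (x j) + ω s(w j, x j)) ∧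
      G.HasPath ω ({w i, w j} ∪ {z | z ∈ K ∧ m (x i) (x j) ≤ D z ∧
        (m (x i) z = D z ∨ m (x j) z = D z)}) 2 (w i) (w j) k := by
    intro i j hi hj
    obtain ⟨k, hk, hp⟩ := hpath _ (hxK i hi) _ (hxK j hj)
    refine ⟨ω s(w i, x i) + (k + ω s(w j, x j)), fun hij => ⟨by omega, ?_⟩⟩
    have h₁ := (hp.symm.cons (hx j hj) (fun h => hwK j hj h.1)).symm.cons (hx i hi) ?_
    · refine (add_comm k (ω s(w j, x j)) ▸ h₁).mono ?_ le_rfl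
      rintro z (rfl | rfl | hz)
      · exact .inl (.inl rfl)
      · exact .inl (.inr rfl)
      · exact .inr hz
    · rintro (h | h)
      · exact hne i j hi hj hij h
      · exact hwK i hi h.1
  choose! P hP using hatt
  have hseg : ∀ i j, i ≤ j → j ≤ N →
      G.HasPath ω {z | ∃ k, i ≤ k ∧ k ≤ j ∧ w k = z} (j - i) (w i) (w j) (j - i) :=
    fun i j hij hj => hasPath_segment hinj hw hw1 hij hj
  have hlong : ∀ i j, i < j → j ≤ N → G.HasPath ω {z | ∃ k ≤ N, w k = z} 0 (w i) (w j)
      (N + t - (j - i)) := by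
    intro i j hij hj
    have h₁ := (hseg j N hj le_rfl).symm
    have h₀ := (hseg 0 i (Nat.zero_le _) (by omega)).symm.mono subset_rfl (Nat.zero_le _)
    have h₂ := (h₁.cons hcl.symm ?_).mono subset_rfl (Nat.zero_le _)
    · have h₃ := h₀.trans h₂ ?_
      · rw [Sym2.eq_swap, ← ht] at h₃
        rw [show N + t - (j - i) = (i - 0) + (t + (N - j)) by omega]
        refine h₃.mono ?_ le_rfl
        rintro z (⟨k, -, hk, rfl⟩ | rfl | ⟨k, -, hk, rfl⟩)
        · exact ⟨k, by omega, rfl⟩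
        · exact ⟨0, by omega, rfl⟩
        · exact ⟨k, hk, rfl⟩
      · rintro z ⟨k, -, hk, rfl⟩ (h | ⟨l, hl, hl', h⟩)
        · exact h
        · exact absurd h (hne _ _ (by omega) (by omega) (by omega))
    · rintro ⟨l, hl, hl', h⟩
      exact absurd h (hne _ _ (by omega) (by omega) (by omega))
  have hA : ∀ i j, i < j → j ≤ N → ¬ 3 ∣ (j - i) + P i j ∧ ¬ 3 ∣ (N + t - (j - i)) + P i j := by
    intro i j hij hj
    have hp := (hP i j (by omega) hj hij.ne).2.symm
    constructor
    · refine HasPath.not_dvd hG (hseg i j hij.le hj) hp ?_ (.inr (by norm_num))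
      rintro z ⟨k, hk, hk', rfl⟩ (h | h)
      · exact h
      · exact absurd h.1 (hwK k (by omega))
    · refine HasPath.not_dvd hG (hlong i j hij hj) hp ?_ (.inr (by norm_num))
      rintro z ⟨k, hk, rfl⟩ (h | h)
      · exact h
      · exact absurd h.1 (hwK k (by omega))
  have hc0 : ¬ 3 ∣ N + t := by
    have h := hseg 0 N (Nat.zero_le _) le_rfl
    refine HasPath.not_dvd hG h ((HasPath.refl (Q := {z | z = w 0}) rfl).cons hcl ?_) ?_
      (.inl (by omega))
    · exact hne _ _ le_rfl (Nat.zero_le _) (by omega)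
    · rintro z - (h | h)
      · exact .inr h
      · exact .inl h
  have hfour : ∀ a b c d, a ≤ N → b ≤ N → c ≤ N → d ≤ N → _ := fun a b c d ha hb hc hd =>
    have h := fun i j k hi hj hk => hum _ (hxK i hi) _ (hxK j hj) _ (hxK k hk)
    four_point (a := m (x a) (x b)) (b := m (x a) (x c)) (c := m (x a) (x d))
      (d := m (x b) (x c)) (e := m (x b) (x d)) (f := m (x c) (x d))
      (by simpa only [hsymm] using h b a c hb ha hc) (by simpa only [hsymm] using h a b c ha hb hc)
      (by simpa only [hsymm] using h a c b ha hc hb) (by simpa only [hsymm] using h b a d hb ha hd)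
      (by simpa only [hsymm] using h a b d ha hb hd) (by simpa only [hsymm] using h a d b ha hd hb)
      (by simpa only [hsymm] using h c a d hc ha hd) (by simpa only [hsymm] using h a c d ha hc hd)
      (by simpa only [hsymm] using h a d c ha hd hc) (by simpa only [hsymm] using h c b d hc hb hd)
      (by simpa only [hsymm] using h b c d hb hc hd) (by simpa only [hsymm] using h b d c hb hd hc)
  have hcross : ∀ a b e f, a < b → b < e → b < f → e ≠ f → e ≤ N → f ≤ N →
      m (x a) (x b) + m (x e) (x f) < m (x a) (x e) + m (x b) (x f) →
      m (x a) (x f) + m (x b) (x e) < m (x a) (x e) + m (x b) (x f) →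
      ¬ 3 ∣ (P a e + (max e f - min e f)) + (P b f + (b - a)) := by
    intro a b e f hab hbe hbf hef he hf h₁ h₂
    have hs : G.HasPath ω {z | ∃ k, min e f ≤ k ∧ k ≤ max e f ∧ w k = z} 0 (w e) (w f)
        (max e f - min e f) := by
      rcases le_total e f with h | h
      · simpa only [h, min_eq_left, max_eq_right] using
          (hseg e f h hf).mono subset_rfl (Nat.zero_le _)
      · simpa only [h, min_eq_right, max_eq_left] using
          ((hseg f e h he).mono subset_rfl (Nat.zero_le _)).symm
    have hs' := ((hseg a b hab.le (by omega)).mono subset_rfl (Nat.zero_le _)).symm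
    have p₁ := ((hP a e (by omega) he (by omega)).2.trans hs (by
      rintro z ((rfl | rfl) | h) ⟨k, hk, hk', h'⟩
      · exact absurd h' (hne _ _ (by omega) (by omega) (by omega))
      · rfl
      · exact absurd h.1 (h' ▸ hwK k (by omega))))
    have p₂ := ((hP b f (by omega) hf (by omega)).2.symm.trans hs' (by
      rintro z ((rfl | rfl) | h) ⟨k, hk, hk', h'⟩
      · rfl
      · exact absurd h' (hne _ _ (by omega) (by omega) (by omega))
      · exact absurd h.1 (h' ▸ hwK k (by omega))))
    refine HasPath.not_dvd hG p₁ p₂ ?_ (.inl (by norm_num))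
    rintro z (((rfl | rfl) | hz) | ⟨k, hk, hk', rfl⟩) (((h | h) | h) | ⟨l, hl, hl', h⟩)
    · exact .inl rfl
    · exact .inl rfl
    · exact .inl rfl
    · exact .inl rfl
    · exact absurd h (hne _ _ (by omega) (by omega) (by omega))
    · exact absurd h (hne _ _ (by omega) (by omega) (by omega))
    · exact absurd h.1 (hwK e (by omega))
    · exact absurd h (hne _ _ (by omega) (by omega) (by omega))
    · exact absurd hz.1 (h ▸ hwK b (by omega))
    · exact absurd hz.1 (h ▸ hwK f (by omega))
    · obtain ⟨hzK, hz₁, hz₂⟩ := hz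
      obtain ⟨-, hz₃, hz₄⟩ := h
      have u := fun i j hi hj => hum _ (hxK i hi) _ hzK _ (hxK j hj)
      have u₁ := u a b (by omega) (by omega)
      have u₂ := u a f (by omega) (by omega)
      have u₃ := u e b (by omega) (by omega)
      have u₄ := u e f (by omega) (by omega)
      rw [hsymm z] at u₁ u₂ u₃ u₄
      have v := fun i j k hi hj hk => hum _ (hxK i hi) _ (hxK j hj) _ (hxK k hk)
      have v₁ := v b a e (by omega) (by omega) (by omega)
      have v₂ := v a b f (by omega) (by omega) (by omega)
      have v₃ := v b f a (by omega) (by omega) (by omega)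
      have v₄ := v e a f (by omega) (by omega) (by omega)
      have v₅ := v a e b (by omega) (by omega) (by omega)
      have v₆ := v e b f (by omega) (by omega) (by omega)
      have v₇ := v a e f (by omega) (by omega) (by omega)
      have v₈ := v b f e (by omega) (by omega) (by omega)
      simp only [hsymm] at *
      omega
    · exact absurd hz.1 (h ▸ hwK l (by omega))
    · exact absurd h (hne _ _ (by omega) (by omega) (by omega))
    · exact .inr h
    · exact absurd h.1 (hwK k (by omega))
    · exact absurd h (hne _ _ (by omega) (by omega) (by omega))
  have hquad : ∀ a b e f, a < b → b < e → e < f → f ≤ N →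
      P a b + P e f + 2 * (m (x a) (x b) + m (x e) (x f)) =
        P a e + P b f + 2 * (m (x a) (x e) + m (x b) (x f)) ∧
      P a b + P e f + 2 * (m (x a) (x b) + m (x e) (x f)) =
        P a f + P b e + 2 * (m (x a) (x f) + m (x b) (x e)) := by
    intro a b e f hab hbe hef hf
    have h₁ := (hP a b (by omega) (by omega) (by omega)).1
    have h₂ := (hP e f (by omega) (by omega) (by omega)).1
    have h₃ := (hP a e (by omega) (by omega) (by omega)).1
    have h₄ := (hP b f (by omega) (by omega) (by omega)).1
    have h₅ := (hP a f (by omega) (by omega) (by omega)).1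
    have h₆ := (hP b e (by omega) (by omega) (by omega)).1
    omega
  rcases (by omega : (N + t) % 3 = 1 ∨ (N + t) % 3 = 2) with h1 | h2
  · have hN5 := hc h1
    have r : ∀ i j, i < j → j ≤ N → ((j - i) % 3 ≠ 2 → P i j % 3 = 1) ∧
        ((j - i) % 3 = 2 → P i j % 3 ≠ 1) := by
      intro i j hij hj
      have := hA i j hij hj
      omega
    have r01 := (r 0 1 (by omega) (by omega)).1 (by norm_num)
    have r03 := (r 0 3 (by omega) (by omega)).1 (by norm_num)
    have r04 := (r 0 4 (by omega) (by omega)).1 (by norm_num)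
    have r05 := (r 0 5 (by omega) (by omega)).2 (by norm_num)
    have r13 := (r 1 3 (by omega) (by omega)).2 (by norm_num)
    have r14 := (r 1 4 (by omega) (by omega)).1 (by norm_num)
    have r15 := (r 1 5 (by omega) (by omega)).1 (by norm_num)
    have r34 := (r 3 4 (by omega) (by omega)).1 (by norm_num)
    have r35 := (r 3 5 (by omega) (by omega)).2 (by norm_num)
    have r45 := (r 4 5 (by omega) (by omega)).1 (by norm_num)
    have s₁ : m (x 0) (x 1) + m (x 3) (x 4) < m (x 0) (x 4) + m (x 1) (x 3) ∧
        m (x 0) (x 1) + m (x 3) (x 4) = m (x 0) (x 3) + m (x 1) (x 4) := by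
      have q₁ := hquad 0 1 3 4 (by omega) (by omega) (by omega) (by omega)
      have : m (x 0) (x 1) + m (x 3) (x 4) ≠ m (x 0) (x 4) + m (x 1) (x 3) := by omega
      have : m (x 0) (x 3) + m (x 1) (x 4) ≠ m (x 0) (x 4) + m (x 1) (x 3) := by omega
      have := hfour 0 1 3 4 (by omega) (by omega) (by omega) (by omega)
      omega
    have s₂ : m (x 0) (x 1) + m (x 4) (x 5) < m (x 0) (x 5) + m (x 1) (x 4) ∧
        m (x 0) (x 1) + m (x 4) (x 5) = m (x 0) (x 4) + m (x 1) (x 5) := by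
      have q₁ := hquad 0 1 4 5 (by omega) (by omega) (by omega) (by omega)
      have : m (x 0) (x 1) + m (x 4) (x 5) ≠ m (x 0) (x 5) + m (x 1) (x 4) := by omega
      have : m (x 0) (x 4) + m (x 1) (x 5) ≠ m (x 0) (x 5) + m (x 1) (x 4) := by omega
      have := hfour 0 1 4 5 (by omega) (by omega) (by omega) (by omega)
      omega
    have q₁ := hquad 0 1 3 5 (by omega) (by omega) (by omega) (by omega)
    have : m (x 0) (x 1) + m (x 3) (x 5) ≠ m (x 0) (x 3) + m (x 1) (x 5) := by omega
    have := hfour 0 1 3 5 (by omega) (by omega) (by omega) (by omega)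
    omega
  · have r : ∀ i j, i < j → j ≤ N → ((j - i) % 3 ≠ 1 → P i j % 3 = 2) ∧
        ((j - i) % 3 = 1 → P i j % 3 ≠ 2) := by
      intro i j hij hj
      have := hA i j hij hj
      omega
    have r01 := (r 0 1 (by omega) (by omega)).2 (by norm_num)
    have r02 := (r 0 2 (by omega) (by omega)).1 (by norm_num)
    have r03 := (r 0 3 (by omega) (by omega)).1 (by norm_num)
    have r12 := (r 1 2 (by omega) (by omega)).2 (by norm_num)
    have r13 := (r 1 3 (by omega) (by omega)).1 (by norm_num)
    have r14 := (r 1 4 (by omega) (by omega)).1 (by norm_num)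
    have r23 := (r 2 3 (by omega) (by omega)).2 (by norm_num)
    have r24 := (r 2 4 (by omega) (by omega)).1 (by norm_num)
    have s₁ : m (x 0) (x 1) + m (x 2) (x 3) < m (x 0) (x 3) + m (x 1) (x 2) ∧
        m (x 0) (x 1) + m (x 2) (x 3) = m (x 0) (x 2) + m (x 1) (x 3) := by
      have q₁ := hquad 0 1 2 3 (by omega) (by omega) (by omega) (by omega)
      have : m (x 0) (x 2) + m (x 1) (x 3) ≠ m (x 0) (x 3) + m (x 1) (x 2) := by omega
      have := hfour 0 1 2 3 (by omega) (by omega) (by omega) (by omega)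
      have := hcross 0 1 2 3 (by omega) (by omega) (by omega) (by omega) (by omega) (by omega)
      omega
    have s₂ : m (x 1) (x 2) + m (x 3) (x 4) < m (x 1) (x 4) + m (x 2) (x 3) ∧
        m (x 1) (x 2) + m (x 3) (x 4) = m (x 1) (x 3) + m (x 2) (x 4) := by
      have q₁ := hquad 1 2 3 4 (by omega) (by omega) (by omega) (by omega)
      have : m (x 1) (x 3) + m (x 2) (x 4) ≠ m (x 1) (x 4) + m (x 2) (x 3) := by omega
      have := hfour 1 2 3 4 (by omega) (by omega) (by omega) (by omega)
      have := hcross 1 2 3 4 (by omega) (by omega) (by omega) (by omega) (by omega) (by omega)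
      omega
    have := hfour 0 1 3 4 (by omega) (by omega) (by omega) (by omega)
    have := hcross 0 1 3 4 (by omega) (by omega) (by omega) (by omega) (by omega) (by omega)
    omega

/-- A cycle through an edge `ab` is that edge together with a path from `b` to `a`. -/
lemma Walk.IsCycle.exists_isPath {v a b : V} {c : G.Walk v v} (hc : c.IsCycle)
    (hab : s(a, b) ∈ c.edges) : ∃ p : G.Walk b a, p.IsPath ∧ s(a, b) ∉ p.edges ∧
      (∀ z ∈ p.support, z ∈ c.support) ∧ c.weight ω = ω s(a, b) + p.weight ω := by
  classical
  have key : ∀ c : G.Walk a a, c.IsCycle → c.snd = b → ∃ p : G.Walk b a, p.IsPath ∧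
      s(a, b) ∉ p.edges ∧ (∀ z ∈ p.support, z ∈ c.support) ∧
      c.weight ω = ω s(a, b) + p.weight ω := by
    intro c hc hb
    cases c with
    | nil => simp at hc
    | cons h p =>
      rw [Walk.snd_cons] at hb
      subst hb
      rw [Walk.cons_isCycle_iff] at hc
      exact ⟨p, hc.1, hc.2, fun z hz => by simp [hz], by simp⟩
  have ha : a ∈ c.support := c.fst_mem_support_of_mem_edges hab
  have hc' : (c.rotate a ha).IsCycle := (Walk.isCycle_rotate ha).2 hc
  have hperm := (c.rotate_edges a ha).perm
  have hw : (c.rotate a ha).weight ω = c.weight ω := (hperm.map ω).sum_eq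
  have hsupp : ∀ z ∈ (c.rotate a ha).support, z ∈ c.support := fun z hz =>
    (c.mem_support_rotate_iff a ha).1 hz
  have hab' : s(a, b) ∈ (c.rotate a ha).edges := hperm.mem_iff.2 hab
  generalize c.rotate a ha = c' at *
  have : c'.snd = b ∨ c'.reverse.snd = b := by
    rw [Walk.snd_reverse]
    cases c' with
    | nil => simp at hc'
    | cons h p =>
      have hp := (Walk.cons_isCycle_iff p h).1 hc'
      rw [Walk.edges_cons, List.mem_cons] at hab'
      rcases hab' with hab' | hab'
      · left
        rw [Walk.snd_cons]
        exact (Sym2.congr_right.1 hab').symm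
      · right
        have hn : ¬ p.Nil := Walk.not_nil_of_isCycle_cons hc'
        rw [Walk.penultimate_cons_of_not_nil _ _ hn]
        exact (hp.1.eq_penultimate_of_mem_edges (Sym2.eq_swap ▸ hab')).symm
  rcases this with h | h
  · obtain ⟨p, h₁, h₂, h₃, h₄⟩ := key c' hc' h
    exact ⟨p, h₁, h₂, fun z hz => hsupp z (h₃ z hz), hw ▸ h₄⟩
  · obtain ⟨p, h₁, h₂, h₃, h₄⟩ := key c'.reverse hc'.reverse h
    refine ⟨p, h₁, h₂, fun z hz => hsupp z (by simpa using h₃ z hz), ?_⟩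
    rw [← hw, ← h₄, Walk.weight_reverse]

/-- `v` has at least three neighbours. -/
def HasThreeNeighbors (G : SimpleGraph V) (v : V) : Prop :=
  ∀ a b, ∃ c, G.Adj v c ∧ c ≠ a ∧ c ≠ b

universe u

/-- Every graph on fewer than `n` vertices, whose vertices other than the ends of some edge have
at least three neighbours, has a cycle of weight divisible by three, where all other edges have
weight one. -/
def HasCycleBelow (n : ℕ) : Prop :=
  ∀ (V : Type u) [Finite V], Nat.card V < n → ∀ (G : SimpleGraph V) (x y : V) (ω : Sym2 V → ℕ),
    G.Adj x y → (∀ e, e ≠ s(x, y) → ω e = 1) → 1 ≤ ω s(x, y) →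
    (∀ v, v ≠ x → v ≠ y → G.HasThreeNeighbors v) → (∃ v, v ≠ x ∧ v ≠ y) → ¬ G.NoCycleModThree ω

lemma HasCycleBelow.hasPath {V : Type u} [Finite V] {G : SimpleGraph V} {ω : Sym2 V → ℕ}
    (ih : HasCycleBelow.{u} (Nat.card V)) (hG : G.NoCycleModThree ω) {A : Set V} {a b : V}
    (ha : a ∈ A) (hb : b ∈ A) (hab : a ≠ b) {r : V} (hr : r ∉ A)
    (hω : ∀ u ∈ A, ∀ v ∈ A, s(u, v) ≠ s(a, b) → ω s(u, v) = 1)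
    (hA : ∀ v ∈ A, v ≠ a → v ≠ b → G.HasThreeNeighbors v ∧ ∀ t, G.Adj v t → t ∈ A)
    (hne : ∃ v ∈ A, v ≠ a ∧ v ≠ b) {τ : ℕ} (hτ : 1 ≤ τ) :
    ∃ k, G.HasPath ω A 2 b a k ∧ 3 ∣ τ + k := by
  classical
  let ω' : Sym2 V → ℕ := fun e => if e = s(a, b) then τ else 1
  let H : SimpleGraph A := (G ⊔ edge a b).induce A
  have hcard : Nat.card A < Nat.card V := by
    rw [Nat.card_coe_set_eq, ← Set.ncard_univ]
    exact Set.ncard_lt_ncard (Set.ssubset_univ_iff.2 fun h => hr (h ▸ Set.mem_univ r))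
  have hinj : ∀ e : Sym2 A, e.map Subtype.val = s(a, b) → e = s(⟨a, ha⟩, ⟨b, hb⟩) := by
    intro e he
    exact Sym2.map.injective Subtype.val_injective (by simpa using he)
  have key := ih A hcard H ⟨a, ha⟩ ⟨b, hb⟩ (fun e => ω' (e.map Subtype.val)) ?_ ?_ ?_ ?_ ?_
  · simp only [NoCycleModThree, not_forall, not_not] at key
    obtain ⟨v, c, hc, hdvd⟩ := key
    let f : H →g G ⊔ edge a b := (Embedding.induce A).toHom
    have hcf : (c.map f).IsCycle :=
      (Walk.isCycle_map_iff_of_injective Subtype.val_injective).2 hc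
    have hw : (c.map f).weight ω' = c.weight (fun e => ω' (e.map Subtype.val)) := by
      simp only [Walk.weight, Walk.edges_map, List.map_map]
      rfl
    have hs : ∀ z ∈ (c.map f).support, z ∈ A := by
      intro z hz
      rw [Walk.support_map, List.mem_map] at hz
      obtain ⟨z, -, rfl⟩ := hz
      exact z.2
    rw [← hw] at hdvd
    have htr : ∀ {u v : V} (p : (G ⊔ edge a b).Walk u v), (∀ z ∈ p.support, z ∈ A) →
        s(a, b) ∉ p.edges → ∃ h : ∀ e ∈ p.edges, e ∈ G.edgeSet,
          (p.transfer G h).weight ω = p.weight ω' := by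
      intro u v p hp hpe
      have h : ∀ e ∈ p.edges, e ∈ G.edgeSet := by
        intro e he
        have h := p.edges_subset_edgeSet he
        induction e with | _ u v
        simp only [mem_edgeSet, sup_adj, edge_adj] at h ⊢
        rcases h with h | ⟨⟨rfl, rfl⟩ | ⟨rfl, rfl⟩, -⟩
        · exact h
        · exact absurd he hpe
        · exact absurd (Sym2.eq_swap ▸ he) hpe
      refine ⟨h, ?_⟩
      rw [Walk.weight, Walk.edges_transfer]
      refine congrArg List.sum (List.map_congr_left fun e he => ?_)
      have hne : e ≠ s(a, b) := fun h => hpe (h ▸ he)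
      simp only [ω', if_neg hne]
      induction e with | _ u v
      exact hω u (hp u (p.fst_mem_support_of_mem_edges he)) v
        (hp v (p.snd_mem_support_of_mem_edges he)) hne
    by_cases hmem : s(a, b) ∈ (c.map f).edges
    · obtain ⟨p, hp, hpe, hps, hpw⟩ := hcf.exists_isPath (ω := ω') hmem
      obtain ⟨h, hw'⟩ := htr p (fun z hz => hs z (hps z hz)) hpe
      refine ⟨_, ⟨p.transfer G h, hp.transfer h, ?_, ?_, rfl⟩, ?_⟩
      · simpa using fun z hz => hs z (hps z hz)
      · rw [Walk.length_transfer]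
        by_contra! hlt
        interval_cases hl : p.length
        · exact hab (Walk.eq_of_length_eq_zero hl).symm
        · cases p with
          | nil => simp at hl
          | cons h' q =>
            cases q with
            | nil => simp [Sym2.eq_swap] at hpe
            | cons => simp at hl
      · rw [hw']
        rw [hpw] at hdvd
        simpa [ω'] using hdvd
    · obtain ⟨h, hw'⟩ := htr (c.map f) hs hmem
      exact absurd (hw' ▸ hdvd) (hG _ _ (hcf.transfer h))
  · simp [H, edge_adj, hab]
  · intro e he
    exact if_neg fun h => he (hinj e h)
  · simpa [ω'] using hτ
  · rintro ⟨v, hv⟩ hva hvb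
    have hva' : v ≠ a := fun h => hva (Subtype.ext h)
    have hvb' : v ≠ b := fun h => hvb (Subtype.ext h)
    obtain ⟨h₁, h₂⟩ := hA v hv hva' hvb'
    rintro ⟨s, hs⟩ ⟨t, ht⟩
    obtain ⟨c, hc, hcs, hct⟩ := h₁ s t
    exact ⟨⟨c, h₂ c hc⟩, by simp [H, hc], fun h => hcs (congrArg Subtype.val h),
      fun h => hct (congrArg Subtype.val h)⟩
  · obtain ⟨v, hv, hva, hvb⟩ := hne
    exact ⟨⟨v, hv⟩, fun h => hva (congrArg Subtype.val h), fun h => hvb (congrArg Subtype.val h)⟩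

end SimpleGraph

namespace SimpleGraph

universe u

variable {V : Type u} {G : SimpleGraph V} {ω : Sym2 V → ℕ}

lemma HasPath.edge {a b : V} (h : G.Adj a b) :
    G.HasPath ω {a, b} 1 a b (ω s(a, b)) :=
  (HasPath.refl (Q := {b}) rfl).cons h h.ne

lemma HasPath.of_reachable {R : Set V} {u v : V} (h : (G.restrict R).Reachable u v)
    (hu : u ∈ R) : ∃ k, G.HasPath ω R 0 u v k := by
  obtain ⟨p, hp⟩ := h.exists_isPath
  refine ⟨_, p.mapLe (restrict_le R), hp.mapLe _, ?_, Nat.zero_le _, rfl⟩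
  rw [Walk.support_mapLe_eq_support]
  clear hp
  clear h
  induction p with
  | nil => simpa using hu
  | cons h p ih =>
    rw [Walk.support_cons]
    rintro z (_ | ⟨_, hz⟩)
    · exact hu
    · exact ih h.2.2 z hz

/-- The vertices that can be reached from `r` inside `R`. -/
def component (G : SimpleGraph V) (R : Set V) (r : V) : Set V :=
  {v | (G.restrict R).Reachable r v}

lemma mem_component_self {R : Set V} {r : V} : r ∈ G.component R r := Reachable.refl r

lemma component_subset {R : Set V} {r : V} (hr : r ∈ R) : G.component R r ⊆ R := by
  rintro v hv
  obtain ⟨k, p, -, hp, -⟩ := HasPath.of_reachable (ω := fun _ => 0) hv hr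
  exact hp _ p.end_mem_support

lemma mem_component_of_adj {R : Set V} {r u v : V} (hr : r ∈ R) (hu : u ∈ G.component R r)
    (huv : G.Adj u v) (hv : v ∈ R) : v ∈ G.component R r :=
  Reachable.trans hu (Adj.reachable ⟨huv, component_subset hr hu, hv⟩)

lemma HasCycleBelow.false_of_edge [Finite V]
    (ih : HasCycleBelow.{u} (Nat.card V)) (hG : G.NoCycleModThree ω) {A : Set V} {a b : V}
    (ha : a ∈ A) (hb : b ∈ A) (hab : G.Adj a b) {r : V} (hr : r ∉ A)
    (hω : ∀ u ∈ A, ∀ v ∈ A, ω s(u, v) = 1)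
    (hA : ∀ v ∈ A, v ≠ a → G.HasThreeNeighbors v ∧ ∀ t, G.Adj v t → t ∈ A) : False := by
  obtain ⟨c, hbc, hca, -⟩ := (hA b hb hab.ne').1 a a
  obtain ⟨k, hk, hdvd⟩ := ih.hasPath hG ha hb hab.ne hr (τ := 1) (fun u hu v hv _ => hω u hu v hv)
    (fun v hv hva _ => hA v hv hva) ⟨c, (hA b hb hab.ne').2 c hbc, hca, hbc.ne'⟩ le_rfl
  refine HasPath.not_dvd hG (HasPath.edge hab) hk ?_ (.inr (by norm_num))
    (by rwa [hω a ha b hb])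
  rintro z (h | h) -
  · exact .inl h
  · exact .inr h

/-- The neighbours outside `L` of the vertices of `L` are among `p` and `q`. -/
def AttachedAt (G : SimpleGraph V) (L : Set V) (p q : V) : Prop :=
  ∀ u ∈ L, ∀ v, G.Adj u v → v ∈ L ∨ v = p ∨ v = q

lemma AttachedAt.compl {L : Set V} {p q : V} (h : G.AttachedAt L p q) :
    G.AttachedAt {v | ¬ (v ∈ L ∨ v = p ∨ v = q)} p q := by
  intro u hu v huv
  by_contra hv
  rw [not_or] at hv
  exact hu (h v ((not_not.1 hv.1).resolve_right hv.2) u huv.symm)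

/-- The part of the theorem's hypotheses on a weighted graph used to bound its connectivity. -/
structure IsCritical (G : SimpleGraph V) (ω : Sym2 V → ℕ) (x y : V) : Prop where
  below : HasCycleBelow.{u} (Nat.card V)
  noCycle : G.NoCycleModThree ω
  adj : G.Adj x y
  weight_eq : ∀ e, e ≠ s(x, y) → ω e = 1
  weight_pos : ∀ e, 1 ≤ ω e
  three : ∀ v, v ≠ x → v ≠ y → G.HasThreeNeighbors v

namespace IsCritical

variable [Finite V] {x y : V}

lemma cut_vertex_aux (h : G.IsCritical ω x y) {L : Set V} {z r : V} (hL : L.Nonempty) (hz : z ∉ L)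
    (hN : G.AttachedAt L z z) (hx : x ∉ L) (hy : y ∉ L) (hr : ¬ (r ∈ L ∨ r = z ∨ r = z)) :
    False := by
  have hthree : ∀ v ∈ L, G.HasThreeNeighbors v := fun v hv =>
    h.three v (fun h => hx (h ▸ hv)) (fun h => hy (h ▸ hv))
  by_cases hzL : ∃ b ∈ L, G.Adj z b
  · obtain ⟨b, hb, hzb⟩ := hzL
    refine h.below.false_of_edge h.noCycle (A := insert z L) (.inl rfl) (.inr hb) hzb (r := r) ?_
      ?_ ?_
    · rintro (rfl | hr')
      · exact hr (by simp)
      · exact hr (by simp [hr'])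
    · rintro u hu v hv
      refine h.weight_eq _ fun he => ?_
      have h₁ : x = z := by
        rcases (Sym2.mem_iff.1 (he ▸ Sym2.mem_mk_left x y)) with rfl | rfl
        · exact hu.resolve_right hx
        · exact hv.resolve_right hx
      have h₂ : y = z := by
        rcases (Sym2.mem_iff.1 (he ▸ Sym2.mem_mk_right x y)) with rfl | rfl
        · exact hu.resolve_right hy
        · exact hv.resolve_right hy
      exact h.adj.ne (h₁.trans h₂.symm)
    · rintro v (rfl | hv) hvz
      · exact absurd rfl hvz
      · refine ⟨hthree v hv, fun t ht => ?_⟩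
        rcases hN v hv t ht with h | h | h
        · exact .inr h
        · exact .inl h
        · exact .inl h
  · push Not at hzL
    have hcl : ∀ v ∈ L, ∀ t, G.Adj v t → t ∈ L := fun v hv t ht =>
      (hN v hv t ht).resolve_right fun h => hzL v hv (by rcases h with rfl | rfl <;> exact ht.symm)
    obtain ⟨a, ha⟩ := hL
    obtain ⟨b, hab, -⟩ := hthree a ha a a
    refine h.below.false_of_edge h.noCycle ha (hcl a ha b hab) hab (r := r) (fun h => hr (.inl h))
      ?_ fun v hv _ => ⟨hthree v hv, hcl v hv⟩
    rintro u hu v hv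
    refine h.weight_eq _ fun he => ?_
    rcases (Sym2.mem_iff.1 (he ▸ Sym2.mem_mk_left x y)) with rfl | rfl
    · exact hx hu
    · exact hx hv

lemma no_cut_vertex (h : G.IsCritical ω x y) {L : Set V} {z : V} (hL : L.Nonempty) (hz : z ∉ L)
    (hN : G.AttachedAt L z z) (v : V) : v ∈ L ∨ v = z := by
  by_contra hv
  have hv : ¬ (v ∈ L ∨ v = z ∨ v = z) := by simpa using hv
  by_cases hL' : x ∈ L ∨ y ∈ L
  · obtain ⟨l, hl⟩ := hL
    have hx : x ∈ L ∨ x = z ∨ x = z := hL'.elim .inl fun hy => hN y hy x h.adj.symm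
    have hy : y ∈ L ∨ y = z ∨ y = z := hL'.elim (fun hx => hN x hx y h.adj) .inl
    exact h.cut_vertex_aux ⟨v, hv⟩ (z := z) (by simp) hN.compl (fun h => h hx)
      (fun h => h hy) (r := l) (by
        rintro (h | h | h)
        · exact h (.inl hl)
        · exact hz (h ▸ hl)
        · exact hz (h ▸ hl))
  · push Not at hL'
    exact h.cut_vertex_aux hL hz hN hL'.1 hL'.2 hv

lemma separating_pair_aux (h : G.IsCritical ω x y) {L : Set V} {p q r : V} (hL : L.Nonempty)
    (hp : p ∉ L) (hq : q ∉ L) (hpq : p ≠ q) (hN : G.AttachedAt L p q) (hx : x ∉ L) (hy : y ∉ L)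
    (hr : ¬ (r ∈ L ∨ r = p ∨ r = q)) : False := by
  obtain ⟨l, hl⟩ := hL
  set R := {v | ¬ (v ∈ L ∨ v = p ∨ v = q)}
  set Z := G.component R r
  have hZ : Z ⊆ R := component_subset hr
  have hNZ : G.AttachedAt Z p q := by
    intro u hu v huv
    rcases hN.compl u (hZ hu) v huv with h | h
    · exact .inl (mem_component_of_adj hr hu huv h)
    · exact .inr h
  have hlZ : l ∉ Z := fun h => hZ h (.inl hl)
  have hpZ : p ∉ Z := fun h => hZ h (.inr (.inl rfl))
  have hqZ : q ∉ Z := fun h => hZ h (.inr (.inr rfl))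
  obtain ⟨z₁, hz₁, hqz₁⟩ : ∃ z ∈ Z, G.Adj q z := by
    by_contra! hcon
    rcases h.no_cut_vertex ⟨r, mem_component_self⟩ hpZ (fun u hu v huv => by
      rcases hNZ u hu v huv with h | h | rfl
      · exact .inl h
      · exact .inr (.inl h)
      · exact absurd huv.symm (hcon u hu)) l with h | rfl
    · exact hlZ h
    · exact hp hl
  obtain ⟨z₂, hz₂, hpz₂⟩ : ∃ z ∈ Z, G.Adj p z := by
    by_contra! hcon
    rcases h.no_cut_vertex ⟨r, mem_component_self⟩ hqZ (fun u hu v huv => by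
      rcases hNZ u hu v huv with h | rfl | h
      · exact .inl h
      · exact absurd huv.symm (hcon u hu)
      · exact .inr (.inl h)) l with h | rfl
    · exact hlZ h
    · exact hq hl
  obtain ⟨k, hk⟩ := HasPath.of_reachable (ω := ω) (Reachable.trans (Reachable.symm hz₁) hz₂)
    (hZ hz₁)
  have hk₁ := hk.cons hqz₁ fun h => h (.inr (.inr rfl))
  have hk₂ := hk₁.symm.cons hpz₂ (by
    rintro (h | h)
    · exact hpq h
    · exact h (.inr (.inl rfl)))
  set t := ω s(p, z₂) + (ω s(q, z₁) + k)
  have ht : 1 ≤ t := le_add_right (h.weight_pos _)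
  have hLt : ∀ v ∈ L, v ≠ p ∧ v ≠ q := fun v hv => ⟨fun h => hp (h ▸ hv), fun h => hq (h ▸ hv)⟩
  have hω : ∀ u ∈ {v | v ∈ L ∨ v = p ∨ v = q}, ∀ v ∈ {v | v ∈ L ∨ v = p ∨ v = q},
      s(u, v) ≠ s(p, q) → ω s(u, v) = 1 := by
    intro u hu v hv huv
    refine h.weight_eq _ fun he => huv ?_
    have h₁ : x = p ∨ x = q := by
      rcases (Sym2.mem_iff.1 (he ▸ Sym2.mem_mk_left x y)) with rfl | rfl
      · exact hu.resolve_left hx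
      · exact hv.resolve_left hx
    have h₂ : y = p ∨ y = q := by
      rcases (Sym2.mem_iff.1 (he ▸ Sym2.mem_mk_right x y)) with rfl | rfl
      · exact hu.resolve_left hy
      · exact hv.resolve_left hy
    have := h.adj.ne
    rw [he]
    grind
  obtain ⟨j, hj, hdvd⟩ := h.below.hasPath h.noCycle (A := {v | v ∈ L ∨ v = p ∨ v = q})
    (.inr (.inl rfl)) (.inr (.inr rfl)) hpq (r := r) hr hω
    (fun v hv hvp hvq => by
      have hv : v ∈ L := hv.resolve_right (not_or.2 ⟨hvp, hvq⟩)
      exact ⟨h.three v (fun h => hx (h ▸ hv)) (fun h => hy (h ▸ hv)), hN v hv⟩)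
    ⟨l, .inl hl, hLt l hl⟩ ht
  refine HasPath.not_dvd h.noCycle hk₂ hj ?_ (.inr (by norm_num)) hdvd
  rintro z (h | h | h) hz
  · exact .inl h
  · exact .inr h
  · exact absurd hz h

lemma no_separating_pair (h : G.IsCritical ω x y) {L : Set V} {p q : V} (hL : L.Nonempty)
    (hp : p ∉ L) (hq : q ∉ L) (hN : G.AttachedAt L p q) (v : V) : v ∈ L ∨ v = p ∨ v = q := by
  by_contra hv
  rcases eq_or_ne p q with rfl | hpq
  · exact hv ((h.no_cut_vertex hL hp hN v).imp_right .inl)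
  by_cases hL' : x ∈ L ∨ y ∈ L
  · obtain ⟨l, hl⟩ := hL
    have hx : x ∈ L ∨ x = p ∨ x = q := hL'.elim .inl fun hy => hN y hy x h.adj.symm
    have hy : y ∈ L ∨ y = p ∨ y = q := hL'.elim (fun hx => hN x hx y h.adj) .inl
    exact h.separating_pair_aux ⟨v, hv⟩ (p := p) (q := q) (by simp) (by simp) hpq hN.compl
      (fun h => h hx) (fun h => h hy) (r := l) (by
        rintro (h | h | h)
        · exact h (.inl hl)
        · exact hp (h ▸ hl)
        · exact hq (h ▸ hl))
  · push Not at hL'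
    exact h.separating_pair_aux hL hp hq hpq hN hL'.1 hL'.2 hv

end IsCritical

lemma reachable_segment {w : ℕ → V} {B : Set V} {i j : ℕ} (hij : i ≤ j)
    (hw : ∀ k, i ≤ k → k < j → G.Adj (w k) (w (k + 1))) (hB : ∀ k, i ≤ k → k ≤ j → w k ∈ B) :
    (G.restrict B).Reachable (w i) (w j) := by
  induction j, hij using Nat.le_induction with
  | base => exact Reachable.refl _
  | succ j hij ih =>
    refine (ih (fun k h₁ h₂ => hw k h₁ (by omega)) fun k h₁ h₂ => hB k h₁ (by omega)).trans ?_
    exact Adj.reachable ⟨hw j hij (by omega), hB _ hij (by omega), hB _ (by omega) le_rfl⟩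

lemma exists_path_sequence {B : Set V} {a b : V} (h : (G.restrict B).Reachable a b) (ha : a ∈ B) :
    ∃ (w : ℕ → V) (N : ℕ), Set.InjOn w (Set.Iic N) ∧ (∀ i < N, G.Adj (w i) (w (i + 1))) ∧
      (∀ i ≤ N, w i ∈ B) ∧ w 0 = a ∧ w N = b := by
  obtain ⟨-, p, hp, hs, -⟩ := HasPath.of_reachable (ω := fun _ => 0) h ha
  refine ⟨p.getVert, p.length, hp.getVert_injOn, fun i hi => p.adj_getVert_succ hi,
    fun i _ => hs _ (p.getVert_mem_support i), by simp, by simp⟩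

/-- A connected set containing `c` and `d` that leaves `a` and `b` joined by a path avoiding the
edge `e`. -/
structure IsCore (G : SimpleGraph V) (e : Sym2 V) (a b c d : V) (K : Set V) : Prop where
  left_mem : c ∈ K
  right_mem : d ∈ K
  left_notMem : a ∉ K
  right_notMem : b ∉ K
  connected : ∀ x ∈ K, (G.restrict K).Reachable c x
  reachable : ((G.deleteEdges {e}).restrict Kᶜ).Reachable a b

namespace IsCore

variable {e : Sym2 V} {a b c d : V} {K : Set V}

lemma symm (h : G.IsCore e a b c d K) : G.IsCore e b a c d K :=
  ⟨h.1, h.2, h.4, h.3, h.5, h.6.symm⟩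

lemma maximal_symm (h : Maximal (G.IsCore e a b c d) K) : Maximal (G.IsCore e b a c d) K :=
  ⟨h.1.symm, fun _ h' => h.2 h'.symm⟩

lemma not_reachable (h : Maximal (G.IsCore e a b c d) K) {s x : V} (hs : s ∉ K) (hsa : s ≠ a)
    (hsb : s ≠ b) (hx : x ∈ K) (hsx : G.Adj s x) :
    ¬ ((G.deleteEdges {e}).restrict (insert s K)ᶜ).Reachable a b := by
  intro hr
  refine hs (h.2 (y := insert s K) ⟨.inr h.1.1, .inr h.1.2, ?_, ?_, ?_, hr⟩ (Set.subset_insert s K)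
    (.inl rfl))
  · rintro (rfl | ha)
    · exact hsa rfl
    · exact h.1.3 ha
  · rintro (rfl | hb)
    · exact hsb rfl
    · exact h.1.4 hb
  · have hmono := fun x hx => (h.1.5 x hx).mono (restrict_mono (Set.subset_insert s K))
    rintro z (rfl | hz)
    · exact (hmono x hx).trans (Adj.reachable ⟨hsx.symm, .inr hx, .inl rfl⟩)
    · exact hmono z hz

lemma eq_or_exists_adj (h : Maximal (G.IsCore e a b c d) K) (he : e = s(a, b))
    (hconn : ∀ (L : Set V) (p q : V), L.Nonempty → p ∉ L → q ∉ L → G.AttachedAt L p q →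
      ∀ v, v ∈ L ∨ v = p ∨ v = q) {v : V} (hv : v ∉ K) :
    v = a ∨ v = b ∨ ∃ x ∈ K, G.Adj v x := by
  classical
  by_contra hcon
  set M := {u | u ∉ K ∧ ¬ (u = a ∨ u = b ∨ ∃ x ∈ K, G.Adj u x)} with hM
  set L := G.component M v
  have hvM : v ∈ M := ⟨hv, hcon⟩
  have hLM : L ⊆ M := component_subset hvM
  obtain ⟨w, N, hinj, hw, hwK, hw0, hwN⟩ := exists_path_sequence h.1.6 h.1.3
  have hLc : c ∉ L := fun h' => (hLM h').1 h.1.1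
  have hN : ∀ u ∈ L, ∀ t, G.Adj u t → t ∈ L ∨ ∃ j ≤ N, w j = t ∧ (j = 0 ∨ j = N ∨
      t ≠ a ∧ t ≠ b ∧ ∃ x ∈ K, G.Adj t x) := by
    intro u hu t hut
    by_cases htM : t ∈ M
    · exact .inl (mem_component_of_adj hvM hu hut htM)
    · right
      have htK : t ∉ K := fun htK => (hLM hu).2 (.inr (.inr ⟨t, htK, hut⟩))
      by_cases hta : t = a
      · exact ⟨0, Nat.zero_le _, hw0.trans hta.symm, .inl rfl⟩
      by_cases htb : t = b
      · exact ⟨N, le_rfl, hwN.trans htb.symm, .inr (.inl rfl)⟩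
      have htx : ∃ x ∈ K, G.Adj t x := by
        by_contra htx
        exact htM ⟨htK, fun h' => h'.elim hta fun h' => h'.elim htb htx⟩
      obtain ⟨x, hx, htx'⟩ := htx
      by_contra! hcon
      refine not_reachable h htK hta htb hx htx' ?_
      rw [← hw0, ← hwN]
      refine reachable_segment (Nat.zero_le _) (fun k _ hk => hw k hk) fun k _ hk => ?_
      rintro (hk' | hk')
      · exact ((hcon k hk hk').2.2 hta htb x hx) htx'
      · exact hwK k hk hk'
  let I : Set ℕ := {j | j ≤ N ∧ w j ∉ L ∧ ∃ u ∈ L, G.Adj u (w j)}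
  have hI : I.Nonempty := by
    by_contra! hI
    have := hconn L c c ⟨v, mem_component_self⟩ hLc hLc (fun u hu t hut => by
      by_contra! ht
      obtain ⟨j, hj, rfl, -⟩ := (hN u hu t hut).resolve_left ht.1
      exact (hI ▸ (⟨hj, ht.1, u, hu, hut⟩ : j ∈ I) : j ∈ (∅ : Set ℕ))) a
    rcases this with h' | h' | h'
    · exact (hLM h').2 (.inl rfl)
    · exact h.1.3 (h' ▸ h.1.1)
    · exact h.1.3 (h' ▸ h.1.1)
  have hbdd : BddAbove I := ⟨N, fun j hj => hj.1⟩
  have hi := Nat.sInf_mem hI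
  have hj := Nat.sSup_mem hI hbdd
  have hi' : ∀ k ∈ I, sInf I ≤ k := fun k hk => Nat.sInf_le hk
  have hj' : ∀ k ∈ I, k ≤ sSup I := fun k hk => le_csSup hbdd hk
  generalize sInf I = i at hi hi'
  generalize sSup I = j at hj hj'
  obtain ⟨k, hk, hki, hkj⟩ : ∃ k ∈ I, k ≠ i ∧ k ≠ j := by
    by_contra! hk
    have := hconn L (w i) (w j) ⟨v, mem_component_self⟩ hi.2.1 hj.2.1 (fun u hu t hut => by
      by_contra! ht
      obtain ⟨l, hl, rfl, -⟩ := (hN u hu t hut).resolve_left ht.1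
      by_cases hli : l = i
      · exact ht.2.1 (hli ▸ rfl)
      · exact ht.2.2 (hk l ⟨hl, ht.1, u, hu, hut⟩ hli ▸ rfl)) c
    rcases this with h' | h' | h'
    · exact hLc h'
    · exact hwK i hi.1 (h' ▸ h.1.1)
    · exact hwK j hj.1 (h' ▸ h.1.1)
  have hik : i < k := lt_of_le_of_ne (hi' k hk) hki.symm
  have hkj : k < j := lt_of_le_of_ne (hj' k hk) hkj
  have hjN := hj.1
  obtain ⟨hkN, hkL, u, hu, huk⟩ := hk
  obtain ⟨-, -, u₁, hu₁, hu₁i⟩ := hi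
  obtain ⟨-, -, u₂, hu₂, hu₂j⟩ := hj
  have hk3 : w k ≠ a ∧ w k ≠ b ∧ ∃ x ∈ K, G.Adj (w k) x := by
    obtain ⟨l, hl, hlk, hl'⟩ := (hN u hu _ huk).resolve_left hkL
    have : l = k := hinj hl hkN hlk
    rcases hl' with h' | h' | h'
    · omega
    · omega
    · exact h'
  obtain ⟨hka, hkb, x, hx, hkx⟩ := hk3
  refine not_reachable h (hwK k hkN) hka hkb hx hkx ?_
  have hwB : ∀ l ≤ N, l ≠ k → w l ∈ (insert (w k) K)ᶜ := by
    rintro l hl hlk (h' | h')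
    · exact hlk (hinj hl hkN h')
    · exact hwK l hl h'
  have hLB : ∀ z ∈ L, z ∈ (insert (w k) K)ᶜ := by
    rintro z hz (h' | h')
    · exact hkL (h' ▸ hz)
    · exact (hLM hz).1 h'
  have hLe : ∀ z ∈ L, ∀ t, G.Adj z t → (G.deleteEdges {e}).Adj z t := by
    intro z hz t hzt
    rw [deleteEdges_adj]
    refine ⟨hzt, fun h' => ?_⟩
    have : z ∈ s(a, b) := he ▸ h' ▸ Sym2.mem_mk_left z t
    rcases Sym2.mem_iff.1 this with h' | h'
    · exact (hLM hz).2 (.inl h')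
    · exact (hLM hz).2 (.inr (.inl h'))
  have hLr : ∀ z ∈ L, ((G.deleteEdges {e}).restrict (insert (w k) K)ᶜ).Reachable v z := by
    intro z hz
    have hz' : (G.restrict M).Reachable v z := hz
    rw [reachable_iff_reflTransGen] at hz'
    clear hz
    induction hz' with
    | refl => exact Reachable.refl _
    | @tail s t hs hst ih =>
      have hs' : s ∈ L := (reachable_iff_reflTransGen v s).2 hs
      have ht' : t ∈ L := mem_component_of_adj hvM hs' hst.1 hst.2.2
      exact ih.trans (Adj.reachable ⟨hLe s hs' t hst.1, hLB s hs', hLB t ht'⟩)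
  rw [← hw0, ← hwN]
  refine (reachable_segment (Nat.zero_le i) (fun l _ hl => hw l (by omega))
    fun l _ hl => hwB l (by omega) (by omega)).trans ?_
  refine .trans ?_ (reachable_segment hjN (fun l _ hl => hw l (by omega))
    fun l _ hl => hwB l (by omega) (by omega))
  refine .trans (Adj.reachable (v := u₁) ?_) (((hLr u₁ hu₁).symm.trans (hLr u₂ hu₂)).trans
    (Adj.reachable ?_))
  · exact ⟨(hLe u₁ hu₁ _ hu₁i).symm, hwB i (by omega) (by omega), hLB u₁ hu₁⟩
  · exact ⟨hLe u₂ hu₂ _ hu₂j, hLB u₂ hu₂, hwB j (by omega) (by omega)⟩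

lemma exists_adj_left (h : Maximal (G.IsCore e a b c d) K) (he : e = s(a, b))
    (hconn : ∀ (L : Set V) (p q : V), L.Nonempty → p ∉ L → q ∉ L → G.AttachedAt L p q →
      ∀ v, v ∈ L ∨ v = p ∨ v = q) (ha : G.HasThreeNeighbors a) : ∃ x ∈ K, G.Adj a x := by
  by_contra! hcon
  obtain ⟨w, N, hinj, hw, hwK, hw0, hwN⟩ := exists_path_sequence h.1.6 h.1.3
  obtain ⟨t, hat, htb, ht1⟩ := ha b (w 1)
  have htK : t ∉ K := fun htK => hcon t htK hat
  obtain ⟨x, hx, htx⟩ := ((eq_or_exists_adj h he hconn htK).resolve_left hat.ne').resolve_left htb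
  obtain ⟨j, hj, rfl⟩ : ∃ j ≤ N, w j = t := by
    by_contra! hcon
    refine not_reachable h htK hat.ne' htb hx htx ?_
    rw [← hw0, ← hwN]
    refine reachable_segment (Nat.zero_le _) (fun k _ hk => hw k hk) fun k _ hk => ?_
    rintro (hk' | hk')
    · exact hcon k hk hk'
    · exact hwK k hk hk'
  have hj0 : j ≠ 0 := fun h => hat.ne (by rw [h, hw0])
  have hj1 : j ≠ 1 := fun h => ht1 (by rw [h])
  have hjN : j ≠ N := fun h => htb (by rw [h, hwN])
  have h1a : w 1 ≠ a := fun h' => by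
    have := hinj (show 1 ≤ N by omega) (show 0 ≤ N by omega) (h'.trans hw0.symm)
    omega
  have h1b : w 1 ≠ b := fun h' => by
    have := hinj (show 1 ≤ N by omega) (show N ≤ N by omega) (h'.trans hwN.symm)
    omega
  have h1K : w 1 ∉ K := hwK 1 (by omega)
  obtain ⟨y, hy, h1y⟩ := ((eq_or_exists_adj h he hconn h1K).resolve_left h1a).resolve_left h1b
  refine not_reachable h h1K h1a h1b hy h1y ?_
  have hwB : ∀ l ≤ N, l ≠ 1 → w l ∈ (insert (w 1) K)ᶜ := by
    rintro l hl hl1 (h' | h')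
    · exact hl1 (hinj hl (show 1 ≤ N by omega) h')
    · exact hwK l hl h'
  rw [← hwN]
  refine .trans (Adj.reachable ⟨?_, ?_, hwB j hj hj1⟩) (reachable_segment hj
    (fun l _ hl => hw l (by omega)) fun l _ hl => hwB l (by omega) (by omega))
  · rw [deleteEdges_adj]
    refine ⟨hat, fun h' => htb ?_⟩
    rw [he] at h'
    exact Sym2.congr_right.1 h'
  · exact hw0 ▸ hwB 0 (by omega) (by omega)

end IsCore

/-- The ends of an edge `ab` that is not a bridge of the graph minus `c` and `d` are joined by a
second path, all of whose vertices are attached to a connected set containing the edge `cd`. -/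
lemma IsCritical.exists_attached_path [Finite V] {x y a b c d : V} (h : G.IsCritical ω x y)
    (hcd : G.Adj c d) (hac : a ≠ c) (had : a ≠ d) (hbc : b ≠ c) (hbd : b ≠ d)
    (ha : G.HasThreeNeighbors a) (hb : G.HasThreeNeighbors b)
    (hr : ((G.deleteEdges {s(a, b)}).restrict {c, d}ᶜ).Reachable a b) :
    ∃ (K : Set V) (w : ℕ → V) (N : ℕ), c ∈ K ∧ d ∈ K ∧
      (∀ x ∈ K, (G.restrict K).Reachable c x) ∧ Set.InjOn w (Set.Iic N) ∧
      (∀ i < N, G.Adj (w i) (w (i + 1)) ∧ s(w i, w (i + 1)) ≠ s(a, b)) ∧ w 0 = a ∧ w N = b ∧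
      ∀ i ≤ N, w i ∉ K ∧ ∃ x ∈ K, G.Adj (w i) x := by
  have hcore : G.IsCore s(a, b) a b c d {c, d} := by
    refine ⟨.inl rfl, .inr rfl, ?_, ?_, ?_, hr⟩
    · rintro (h | h)
      · exact hac h
      · exact had h
    · rintro (h | h)
      · exact hbc h
      · exact hbd h
    · rintro z (rfl | rfl)
      · exact Reachable.refl _
      · exact Adj.reachable ⟨hcd, .inl rfl, .inr rfl⟩
  obtain ⟨K, -, hK⟩ := Finite.exists_le_maximal hcore
  have hconn : ∀ (L : Set V) (p q : V), L.Nonempty → p ∉ L → q ∉ L → G.AttachedAt L p q →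
      ∀ v, v ∈ L ∨ v = p ∨ v = q := fun L p q h₁ h₂ h₃ h₄ => h.no_separating_pair h₁ h₂ h₃ h₄
  obtain ⟨w, N, hinj, hw, hwK, hw0, hwN⟩ := exists_path_sequence hK.1.6 hK.1.3
  refine ⟨K, w, N, hK.1.1, hK.1.2, hK.1.5, hinj, fun i hi => ?_, hw0, hwN,
    fun i hi => ⟨hwK i hi, ?_⟩⟩
  · simpa [deleteEdges_adj] using hw i hi
  · rcases IsCore.eq_or_exists_adj hK rfl hconn (hwK i hi) with h' | h' | h'
    · exact h' ▸ IsCore.exists_adj_left hK rfl hconn ha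
    · exact h' ▸ IsCore.exists_adj_left (IsCore.maximal_symm hK) Sym2.eq_swap hconn hb
    · exact h'

lemma hasPath_sequence {w : ℕ → V} {N : ℕ} (hinj : Set.InjOn w (Set.Iic N))
    (hw : ∀ i < N, G.Adj (w i) (w (i + 1))) :
    G.HasPath ω {z | ∃ k ≤ N, w k = z} N (w 0) (w N)
      (∑ i ∈ Finset.range N, ω s(w i, w (i + 1))) := by
  induction N with
  | zero => exact HasPath.refl ⟨0, le_rfl, rfl⟩
  | succ N ih =>
    have hp := (ih (hinj.mono (Set.Iic_subset_Iic.2 N.le_succ)) fun i hi =>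
      hw i (hi.trans N.lt_succ_self)).symm.cons (hw N N.lt_succ_self).symm ?_
    · rw [Finset.sum_range_succ, add_comm (Finset.sum _ _), Sym2.eq_swap (a := w N)]
      refine hp.symm.mono ?_ le_rfl
      rintro z (rfl | ⟨k, hk, rfl⟩)
      · exact ⟨_, le_rfl, rfl⟩
      · exact ⟨k, hk.trans N.le_succ, rfl⟩
    · rintro ⟨k, hk, hkN⟩
      have : k = N + 1 := hinj (hk.trans N.le_succ) (Set.mem_Iic.2 le_rfl) hkN
      omega

namespace NoCycleModThree

lemma not_dvd_sequence (hG : G.NoCycleModThree ω) {w : ℕ → V} {N : ℕ}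
    (hinj : Set.InjOn w (Set.Iic N)) (hw : ∀ i < N, G.Adj (w i) (w (i + 1))) (hN : 2 ≤ N)
    (hcl : G.Adj (w N) (w 0)) :
    ¬ 3 ∣ (∑ i ∈ Finset.range N, ω s(w i, w (i + 1))) + ω s(w N, w 0) := by
  refine HasPath.not_dvd hG (hasPath_sequence hinj hw) (HasPath.edge hcl) ?_ (.inl (by omega))
  rintro z - (h | h)
  · exact .inr h
  · exact .inl h

lemma triangle (hG : G.NoCycleModThree ω) {a b c : V} (hab : G.Adj a b) (hbc : G.Adj b c)
    (hca : G.Adj c a) : ¬ 3 ∣ ω s(a, b) + ω s(b, c) + ω s(c, a) := by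
  have hp := (HasPath.edge (ω := ω) hbc).cons hab (by
    rintro (h | h)
    · exact hab.ne h
    · exact hca.ne' h)
  refine HasPath.not_dvd hG hp (HasPath.edge hca) ?_ (.inl (by omega))
  rintro z - (h | h)
  · exact .inr h
  · exact .inl h

lemma hexagon (hG : G.NoCycleModThree ω) {a b c d e f : V} (hn : [a, b, c, d, e, f].Nodup)
    (hab : G.Adj a b ∧ ω s(a, b) = 1) (hbc : G.Adj b c ∧ ω s(b, c) = 1)
    (hcd : G.Adj c d ∧ ω s(c, d) = 1) (hde : G.Adj d e ∧ ω s(d, e) = 1)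
    (hef : G.Adj e f ∧ ω s(e, f) = 1) (hfa : G.Adj f a ∧ ω s(f, a) = 1) : False := by
  simp only [List.nodup_cons, List.mem_cons, List.not_mem_nil, or_false, not_or] at hn
  have hp := ((((HasPath.edge (ω := ω) hef.1).cons hde.1 (by simp [hn])).cons hcd.1
    (by simp [hn])).cons hbc.1 (by simp [hn])).cons hab.1 (by simp [hn])
  refine HasPath.not_dvd hG hp (HasPath.edge hfa.1) ?_ (.inl (by omega)) ?_
  · rintro z - (h | h)
    · exact .inr h
    · exact .inl h
  · rw [hab.2, hbc.2, hcd.2, hde.2, hef.2, hfa.2]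
    norm_num

end NoCycleModThree

namespace IsCritical

variable {x y : V}

lemma weight_left (h : G.IsCritical ω x y) {u : V} (hu : u ∉ ({x, y} : Set V)) (v : V) :
    ω s(u, v) = 1 :=
  h.weight_eq _ fun h' => hu (by simpa using (h' ▸ Sym2.mem_mk_left u v : u ∈ s(x, y)))

lemma weight_right (h : G.IsCritical ω x y) {u : V} (hu : u ∉ ({x, y} : Set V)) (v : V) :
    ω s(v, u) = 1 := Sym2.eq_swap (a := v) ▸ h.weight_left hu v

lemma three' (h : G.IsCritical ω x y) {u : V} (hu : u ∉ ({x, y} : Set V)) :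
    G.HasThreeNeighbors u :=
  h.three u (fun h => hu (.inl h)) fun h => hu (.inr h)

end IsCritical

/-- `w 0, …, w N` is a path in `B`. -/
structure IsPathSequence (G : SimpleGraph V) (B : Set V) (w : ℕ → V) (N : ℕ) : Prop where
  injOn : Set.InjOn w (Set.Iic N)
  adj : ∀ i < N, G.Adj (w i) (w (i + 1))
  mem : ∀ i ≤ N, w i ∈ B

namespace IsPathSequence

variable {B : Set V} {w : ℕ → V} {N : ℕ}

lemma reverse (h : G.IsPathSequence B w N) : G.IsPathSequence B (fun i => w (N - i)) N where
  injOn i hi j hj hij := by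
    have hi' : i ≤ N := hi
    have hj' : j ≤ N := hj
    have : N - i = N - j := h.injOn (Nat.sub_le N i) (Nat.sub_le N j) hij
    omega
  adj i hi := by
    have := (h.adj (N - (i + 1)) (by omega)).symm
    rwa [show N - (i + 1) + 1 = N - i by omega] at this
  mem i _ := h.mem _ (Nat.sub_le N i)

lemma cons {t : V} (h : G.IsPathSequence B w N) (ht : G.Adj t (w 0)) (htB : t ∈ B)
    (htw : ∀ i ≤ N, w i ≠ t) :
    G.IsPathSequence B (fun i => if i = 0 then t else w (i - 1)) (N + 1) where
  injOn i hi j hj hij := by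
    have hi' : i ≤ N + 1 := hi
    have hj' : j ≤ N + 1 := hj
    simp only at hij
    split_ifs at hij with h₁ h₂ h₂
    · omega
    · exact absurd hij.symm (htw _ (by omega))
    · exact absurd hij (htw _ (by omega))
    · have : i - 1 = j - 1 := h.injOn (show i - 1 ≤ N by omega) (show j - 1 ≤ N by omega) hij
      omega
  adj i hi := by
    rcases i with _ | i
    · simpa using ht
    · simpa using h.adj i (by omega)
  mem i hi := by
    rcases i with _ | i
    · simpa using htB
    · simpa using h.mem i (by omega)

lemma tail (h : G.IsPathSequence B w (N + 1)) : G.IsPathSequence B (fun i => w (i + 1)) N where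
  injOn i hi j hj hij := by
    have hi' : i ≤ N := hi
    have hj' : j ≤ N := hj
    have : i + 1 = j + 1 := h.injOn (show i + 1 ≤ N + 1 by omega) (show j + 1 ≤ N + 1 by omega) hij
    omega
  adj i hi := h.adj (i + 1) (by omega)
  mem i hi := h.mem (i + 1) (by omega)

lemma not_adj (hT : ∀ a ∈ B, ∀ b ∈ B, G.Adj a b →
      ¬ ((G.deleteEdges {s(a, b)}).restrict B).Reachable a b)
    (h : G.IsPathSequence B w N) {i j : ℕ} (hij : i + 2 ≤ j) (hj : j ≤ N) :
    ¬ G.Adj (w i) (w j) := by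
  intro hadj
  refine hT _ (h.mem i (by omega)) _ (h.mem j hj) hadj ?_
  refine reachable_segment (by omega) (fun k h₁ h₂ => ?_) fun k _ h₂ => h.mem k (by omega)
  rw [deleteEdges_adj]
  refine ⟨h.adj k (by omega), fun h' => ?_⟩
  have hinj : ∀ a b, a ≤ N → b ≤ N → w a = w b → a = b := fun a b ha hb hab => h.injOn ha hb hab
  rcases Sym2.eq_iff.1 h' with h' | h'
  · have := hinj _ _ (by omega) (by omega) h'.1
    have := hinj _ _ (by omega) (by omega) h'.2
    omega
  · have := hinj _ _ (by omega) (by omega) h'.1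
    omega

/-- The only neighbour in `B` of the first vertex of a longest path of a forest. -/
lemma eq_of_adj_zero (hT : ∀ a ∈ B, ∀ b ∈ B, G.Adj a b →
      ¬ ((G.deleteEdges {s(a, b)}).restrict B).Reachable a b)
    (hmax : ∀ w', ¬ G.IsPathSequence B w' (N + 1)) (h : G.IsPathSequence B w N) {t : V}
    (ht : t ∈ B) (hadj : G.Adj (w 0) t) : 1 ≤ N ∧ t = w 1 := by
  by_cases htw : ∃ j ≤ N, w j = t
  · obtain ⟨j, hj, rfl⟩ := htw
    rcases j with _ | _ | j
    · exact absurd rfl hadj.ne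
    · exact ⟨hj, rfl⟩
    · exact absurd hadj (h.not_adj hT (by omega) hj)
  · push Not at htw
    exact absurd (h.cons hadj.symm ht htw) (hmax _)

end IsPathSequence

namespace IsCritical

variable [Finite V] {x y : V}

/-- Some edge lies on a cycle avoiding `x` and `y`. -/
lemma exists_edge (h : G.IsCritical ω x y) (hne : ∃ v, v ≠ x ∧ v ≠ y) :
    ∃ a ∈ ({x, y}ᶜ : Set V), ∃ b ∈ ({x, y}ᶜ : Set V), G.Adj a b ∧
      ((G.deleteEdges {s(a, b)}).restrict {x, y}ᶜ).Reachable a b := by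
  by_contra! hT
  set B : Set V := {x, y}ᶜ with hB
  obtain ⟨v, hvx, hvy⟩ := hne
  obtain ⟨N, ⟨w, hw⟩, hmax⟩ : ∃ N, (∃ w, G.IsPathSequence B w N) ∧
      ∀ w', ¬ G.IsPathSequence B w' (N + 1) := by
    by_contra! hcon
    have hall : ∀ N, ∃ w, G.IsPathSequence B w N := by
      intro N
      induction N with
      | zero =>
        refine ⟨fun _ => v, ⟨fun i hi j hj _ => ?_, by omega, fun i _ => ?_⟩⟩
        · exact (Nat.le_zero.1 hi).trans (Nat.le_zero.1 hj).symm
        · rintro (h | h)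
          · exact hvx h
          · exact hvy h
      | succ N ih => exact hcon N ih
    obtain ⟨w, hw⟩ := hall (Nat.card V)
    have h₁ := hw.injOn.ncard_image
    have h₂ := Set.ncard_le_card (w '' Set.Iic (Nat.card V))
    rw [h₁, Set.ncard_eq_toFinset_card'] at h₂
    simp at h₂
  have hmemB : ∀ t, t ≠ x → t ≠ y → t ∈ B := by
    rintro t h₁ h₂ (h | h)
    · exact h₁ h
    · exact h₂ h
  have hend : ∀ w, G.IsPathSequence B w N → 1 ≤ N ∧ G.Adj (w 0) x ∧ G.Adj (w 0) y := by
    intro w hw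
    have h3 := h.three' (hw.mem 0 (Nat.zero_le _))
    refine ⟨?_, ?_, ?_⟩
    · obtain ⟨t, ht, htx, hty⟩ := h3 x y
      exact (hw.eq_of_adj_zero hT hmax (hmemB t htx hty) ht).1
    · obtain ⟨t, ht, ht1, hty⟩ := h3 (w 1) y
      by_cases htx : t = x
      · exact htx ▸ ht
      · exact absurd (hw.eq_of_adj_zero hT hmax (hmemB t htx hty) ht).2 ht1
    · obtain ⟨t, ht, ht1, htx⟩ := h3 (w 1) x
      by_cases hty : t = y
      · exact hty ▸ ht
      · exact absurd (hw.eq_of_adj_zero hT hmax (hmemB t htx hty) ht).2 ht1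
  obtain ⟨hN, h0x, h0y⟩ := hend w hw
  obtain ⟨-, hNx, hNy⟩ := hend _ hw.reverse
  simp only [Nat.sub_zero] at hNx hNy
  have hB0 := hw.mem 0 (Nat.zero_le _)
  have hB1 := hw.mem 1 hN
  have h01 := hw.adj 0 hN
  rw [zero_add] at h01
  have hno : ∀ t, G.Adj (w 0) t → ¬ G.Adj (w 1) t := by
    intro t h0 h1
    apply h.noCycle.triangle h01 h1 h0.symm
    rw [h.weight_left hB0, h.weight_left hB1, h.weight_right hB0]
  obtain ⟨z, h1z, hz0, hz2⟩ := h.three' hB1 (w 0) (w 2)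
  have hzB : z ∈ B := hmemB z (fun hz => hno x h0x (hz ▸ h1z)) fun hz => hno y h0y (hz ▸ h1z)
  have hN2 : 2 ≤ N := by
    by_contra hN2
    obtain rfl : N = 1 := by omega
    exact hz0 (hw.reverse.eq_of_adj_zero hT hmax hzB (by simpa using h1z)).2
  have hzw : ∀ i ≤ N, w i ≠ z := by
    rintro (_ | _ | _ | i) hi rfl
    · exact hz0 rfl
    · exact h1z.ne rfl
    · exact hz2 rfl
    · exact hw.not_adj hT (by omega) hi h1z
  obtain ⟨M, rfl⟩ : ∃ M, N = M + 1 := ⟨N - 1, by omega⟩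
  obtain ⟨-, hzx, hzy⟩ := hend _ (hw.tail.cons (t := z) h1z.symm hzB fun i hi => hzw _ (by omega))
  simp only [if_true] at hzx hzy
  have hBN := hw.mem (M + 1) le_rfl
  have hne : ∀ i j, i ≤ M + 1 → j ≤ M + 1 → i ≠ j → w i ≠ w j :=
    fun i j hi hj hij h' => hij (hw.injOn hi hj h')
  have hneB : ∀ t ∈ B, t ≠ x ∧ t ≠ y := fun t ht =>
    ⟨fun h => ht (.inl h), fun h => ht (.inr h)⟩
  refine h.noCycle.hexagon (a := w 1) (b := w 0) (c := x) (d := w (M + 1)) (e := y) (f := z) ?_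
    ⟨h01.symm, h.weight_left hB1 _⟩ ⟨h0x, h.weight_left hB0 _⟩ ⟨hNx.symm, h.weight_right hBN _⟩
    ⟨hNy, h.weight_left hBN _⟩ ⟨hzy.symm, h.weight_right hzB _⟩ ⟨h1z.symm, h.weight_left hzB _⟩
  have a1 := hneB _ hB0
  have a2 := hneB _ hB1
  have a3 := hneB _ hBN
  have a4 := hneB _ hzB
  have a5 := hne 1 0 (by omega) (by omega) (by omega)
  have a6 := hne 1 (M + 1) (by omega) (by omega) (by omega)
  have a7 := hne 0 (M + 1) (by omega) (by omega) (by omega)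
  have a8 := hzw 0 (by omega)
  have a9 := hzw 1 (by omega)
  have a10 := hzw (M + 1) (by omega)
  simp only [List.nodup_cons, List.mem_cons, List.not_mem_nil, or_false, not_or, not_false_iff,
    List.nodup_nil, and_true]
  exact ⟨⟨a5, a2.1, a6, a2.2, a9⟩, ⟨a1.1, a7, a1.2, a8⟩, ⟨a3.1.symm, h.adj.ne, a4.1.symm⟩,
    ⟨a3.2, a10⟩, a4.2.symm⟩

end IsCritical

/-- A four-cycle avoiding `x` and `y`, attached to a connected set containing `x` and `y`. -/
structure IsAttachedSquare (G : SimpleGraph V) (K : Set V) (x y a b c d : V) : Prop where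
  left_mem : x ∈ K
  right_mem : y ∈ K
  connected : ∀ z ∈ K, (G.restrict K).Reachable x z
  adj₁ : G.Adj a b
  adj₂ : G.Adj b c
  adj₃ : G.Adj c d
  adj₄ : G.Adj d a
  ne₁ : a ≠ c
  ne₂ : b ≠ d
  attached₁ : a ∉ K ∧ ∃ z ∈ K, G.Adj a z
  attached₂ : b ∉ K ∧ ∃ z ∈ K, G.Adj b z
  attached₃ : c ∉ K ∧ ∃ z ∈ K, G.Adj c z
  attached₄ : d ∉ K ∧ ∃ z ∈ K, G.Adj d z

namespace IsAttachedSquare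

variable {K : Set V} {x y a b c d : V}

lemma rotate (h : G.IsAttachedSquare K x y a b c d) : G.IsAttachedSquare K x y b c d a :=
  ⟨h.1, h.2, h.3, h.5, h.6, h.7, h.4, h.9, h.8.symm, h.11, h.12, h.13, h.10⟩

lemma disjoint (h : G.IsAttachedSquare K x y a b c d) : a ∉ ({x, y} : Set V) := by
  rintro (rfl | rfl)
  · exact h.10.1 h.1
  · exact h.10.1 h.2

end IsAttachedSquare

namespace IsCritical

variable [Finite V] {x y a b c d : V} {K : Set V}

lemma exists_square (h : G.IsCritical ω x y) (hne : ∃ v, v ≠ x ∧ v ≠ y) :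
    ∃ K a b c d, G.IsAttachedSquare K x y a b c d := by
  obtain ⟨a, ha, b, hb, hab, hr⟩ := h.exists_edge hne
  obtain ⟨K, w, N, hx, hy, hK, hinj, hw, rfl, rfl, hatt⟩ := h.exists_attached_path h.adj
    (fun h => ha (.inl h)) (fun h => ha (.inr h)) (fun h => hb (.inl h)) (fun h => hb (.inr h))
    (h.three' ha) (h.three' hb) hr
  have hB : ∀ i ≤ N, w i ∉ ({x, y} : Set V) := by
    rintro i hi (h' | h')
    · exact (hatt i hi).1 (h' ▸ hx)
    · exact (hatt i hi).1 (h' ▸ hy)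
  have hw1 : ∀ i < N, ω s(w i, w (i + 1)) = 1 := fun i hi => h.weight_left (hB i hi.le) _
  have hcl : ω s(w N, w 0) = 1 := h.weight_left (hB N le_rfl) _
  have hadj : ∀ i < N, G.Adj (w i) (w (i + 1)) := fun i hi => (hw i hi).1
  have hN0 : N ≠ 0 := by
    rintro rfl
    exact hab.ne rfl
  have hN1 : N ≠ 1 := by
    rintro rfl
    exact (hw 0 one_pos).2 rfl
  have hS := h.noCycle.not_dvd_sequence hinj hadj (by omega) hab.symm
  rw [Finset.sum_congr rfl fun i hi => hw1 i (Finset.mem_range.1 hi), hcl] at hS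
  simp only [Finset.sum_const, Finset.card_range, smul_eq_mul, mul_one] at hS
  by_cases hN : 4 ≤ N
  · exact (not_noCycleModThree_of_attached h.weight_pos h.noCycle hK hinj hadj hw1 hN hab.symm
      (by omega) (fun i hi => (hatt i hi).1) fun i hi => (hatt i hi).2).elim
  obtain rfl : N = 3 := by omega
  refine ⟨K, w 0, w 1, w 2, w 3, hx, hy, hK, hadj 0 (by omega), hadj 1 (by omega),
    hadj 2 (by omega), hab.symm, fun h' => ?_, fun h' => ?_, hatt 0 (by omega), hatt 1 (by omega),
    hatt 2 (by omega), hatt 3 (by omega)⟩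
  · exact absurd (hinj (show 0 ≤ 3 by omega) (show 2 ≤ 3 by omega) h') (by omega)
  · exact absurd (hinj (show 1 ≤ 3 by omega) (show 3 ≤ 3 by omega) h') (by omega)

lemma adj_of_square (h : G.IsCritical ω x y) (hs : G.IsAttachedSquare K x y a b c d) :
    (G.Adj a x ∧ G.Adj b y) ∨ (G.Adj a y ∧ G.Adj b x) := by
  have hr : ((G.deleteEdges {s(a, b)}).restrict {c, d}ᶜ).Reachable a b := by
    obtain ⟨haK, p, hp, hap⟩ := hs.attached₁
    obtain ⟨hbK, q, hq, hbq⟩ := hs.attached₂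
    have hmem : ∀ z ∈ K, z ∈ ({c, d}ᶜ : Set V) := by
      rintro z hz (h' | h')
      · exact hs.attached₃.1 (h' ▸ hz)
      · exact hs.attached₄.1 (h' ▸ hz)
    have hdel : ∀ u, ∀ v ∈ K, G.Adj u v → (G.deleteEdges {s(a, b)}).Adj u v := by
      intro u v hv huv
      rw [deleteEdges_adj]
      refine ⟨huv, fun h' => ?_⟩
      have : v ∈ s(a, b) := h' ▸ Sym2.mem_mk_right u v
      rcases Sym2.mem_iff.1 this with rfl | rfl
      · exact haK hv
      · exact hbK hv
    have hle : G.restrict K ≤ (G.deleteEdges {s(a, b)}).restrict {c, d}ᶜ :=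
      fun u v huv => ⟨hdel u v huv.2.2 huv.1, hmem u huv.2.1, hmem v huv.2.2⟩
    have hpq := (((hs.connected p hp).symm).trans (hs.connected q hq)).mono hle
    refine .trans (Adj.reachable ⟨hdel a p hp hap, ?_, hmem p hp⟩)
      (hpq.trans (Adj.reachable ⟨(hdel b q hq hbq).symm, hmem q hq, ?_⟩))
    · rintro (h' | h')
      · exact hs.ne₁ h'
      · exact hs.adj₄.ne' h'
    · rintro (h' | h')
      · exact hs.adj₂.ne h'
      · exact hs.ne₂ h'
  have ha := hs.disjoint
  have hb := hs.rotate.disjoint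
  have hc := hs.rotate.rotate.disjoint
  have hd := hs.rotate.rotate.rotate.disjoint
  obtain ⟨L, w, N, hcL, hdL, hL, hinj, hw, hwa, hwb, hatt⟩ := h.exists_attached_path hs.adj₃
    hs.ne₁ hs.adj₄.ne' hs.adj₂.ne hs.ne₂ (h.three' ha) (h.three' hb) hr
  have hadj : ∀ i < N, G.Adj (w i) (w (i + 1)) := fun i hi => (hw i hi).1
  have hcl : G.Adj (w N) (w 0) := by rw [hwa, hwb]; exact hs.adj₁.symm
  have hcl1 : ω s(w N, w 0) = 1 := by rw [hwb]; exact h.weight_left hb _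
  have hN0 : N ≠ 0 := by
    rintro rfl
    exact hcl.ne rfl
  have hN1 : N ≠ 1 := by
    rintro rfl
    exact (hw 0 one_pos).2 (by rw [hwa, zero_add, hwb])
  have hS₁ := h.noCycle.not_dvd_sequence hinj hadj (by omega) hcl
  have hS₂ : ¬ 3 ∣ (∑ i ∈ Finset.range N, ω s(w i, w (i + 1))) + 3 := by
    have hp := ((HasPath.edge (ω := ω) hs.adj₄).cons hs.adj₃ (by
      rintro (h' | h')
      · exact hs.adj₃.ne h'
      · exact hs.ne₁ h'.symm)).cons hs.adj₂ (by
      rintro (h' | h' | h')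
      · exact hs.adj₂.ne h'
      · exact hs.ne₂ h'
      · exact hs.adj₁.ne h'.symm)
    rw [h.weight_left hb, h.weight_left hc, h.weight_left hd] at hp
    have hq := hasPath_sequence (ω := ω) hinj hadj
    rw [hwa, hwb] at hq
    refine HasPath.not_dvd h.noCycle hq hp ?_ (.inr (by omega))
    rintro z ⟨k, hk, hkz⟩ (h' | h' | h' | h')
    · exact .inr h'
    · exact absurd (hkz.trans h' ▸ hcL) (hatt k hk).1
    · exact absurd (hkz.trans h' ▸ hdL) (hatt k hk).1
    · exact .inl h'
  rw [hcl1] at hS₁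
  by_cases hf : ∃ j < N, s(w j, w (j + 1)) = s(x, y)
  · obtain ⟨j, hj, hjf⟩ := hf
    have hj' : w j ∈ ({x, y} : Set V) := by
      simpa using (hjf ▸ Sym2.mem_mk_left _ _ : w j ∈ s(x, y))
    have hj1 : w (j + 1) ∈ ({x, y} : Set V) := by
      simpa using (hjf ▸ Sym2.mem_mk_right _ _ : w (j + 1) ∈ s(x, y))
    have hj0 : j ≠ 0 := by
      rintro rfl
      exact ha (hwa ▸ hj')
    have hjN : j + 1 ≠ N := by
      rintro rfl
      exact hb (hwb ▸ hj1)
    have hunit : ∀ i < N, i ≠ j → ω s(w i, w (i + 1)) = 1 := by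
      intro i hi hij
      refine h.weight_eq _ fun h' => ?_
      rcases Sym2.eq_iff.1 (h'.trans hjf.symm) with h' | h'
      · exact hij (hinj hi.le hj.le h'.1)
      · have h₁ : i = j + 1 := hinj hi.le hj h'.1
        have h₂ : i + 1 = j := hinj hi hj.le h'.2
        omega
    have hsum : (∑ i ∈ Finset.range N, ω s(w i, w (i + 1))) = N - 1 + ω s(w j, w (j + 1)) := by
      rw [← Finset.sum_erase_add _ _ (Finset.mem_range.2 hj), Finset.sum_congr rfl (g := fun _ => 1)]
      · simp [Finset.card_erase_of_mem (Finset.mem_range.2 hj)]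
      · intro i hi
        rw [Finset.mem_erase, Finset.mem_range] at hi
        exact hunit i hi.2 hi.1
    rw [hsum] at hS₁ hS₂
    by_cases hN : 4 ≤ N
    · exfalso
      let r : ℕ → ℕ := fun i => if j + 1 + i ≤ N then j + 1 + i else j + i - N
      have hr₀ : r 0 = j + 1 := by simp only [r]; split_ifs <;> omega
      have hrN : r N = j := by simp only [r]; split_ifs <;> omega
      have hrle : ∀ i ≤ N, r i ≤ N := fun i hi => by simp only [r]; split_ifs <;> omega
      have hrinj : ∀ i ≤ N, ∀ k ≤ N, r i = r k → i = k := fun i hi k hk hik => by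
        simp only [r] at hik
        split_ifs at hik <;> omega
      have hrstep : ∀ i < N, (r i < N ∧ r i ≠ j ∧ r (i + 1) = r i + 1) ∨
          (r i = N ∧ r (i + 1) = 0) := fun i hi => by
        simp only [r]
        split_ifs <;> omega
      refine not_noCycleModThree_of_attached (w := fun i => w (r i)) (N := N) h.weight_pos
        h.noCycle hL (fun i hi k hk hik => hrinj i hi k hk (hinj (hrle i hi) (hrle k hk) hik))
        (fun i hi => ?_) (fun i hi => ?_) hN ?_ ?_ (fun i hi => (hatt _ (hrle i hi)).1)
        fun i hi => (hatt _ (hrle i hi)).2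
      · rcases hrstep i hi with ⟨h₁, -, h₂⟩ | ⟨h₁, h₂⟩
        · simpa only [h₂] using hadj _ h₁
        · simpa only [h₁, h₂] using hcl
      · rcases hrstep i hi with ⟨h₁, h₂, h₃⟩ | ⟨h₁, h₂⟩
        · simpa only [h₃] using hunit _ h₁ h₂
        · simpa only [h₁, h₂] using hcl1
      · simpa only [hr₀, hrN] using hadj j hj
      · simp only [hr₀, hrN]
        omega
    · obtain rfl : N = 3 := by omega
      obtain rfl : j = 1 := by omega
      have h₁ := hadj 0 (by omega)
      have h₂ := hadj 2 (by omega)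
      rw [hwa] at h₁
      rw [hwb] at h₂
      rcases Sym2.eq_iff.1 hjf with ⟨h', h''⟩ | ⟨h', h''⟩
      · exact .inl ⟨h' ▸ h₁, h'' ▸ h₂.symm⟩
      · exact .inr ⟨h' ▸ h₁, h'' ▸ h₂.symm⟩
  · exfalso
    push Not at hf
    have hw1 : ∀ i < N, ω s(w i, w (i + 1)) = 1 := fun i hi => h.weight_eq _ (hf i hi)
    rw [Finset.sum_congr rfl fun i hi => hw1 i (Finset.mem_range.1 hi)] at hS₁ hS₂
    simp only [Finset.sum_const, Finset.card_range, smul_eq_mul, mul_one] at hS₁ hS₂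
    exact not_noCycleModThree_of_attached h.weight_pos h.noCycle hL hinj hadj hw1 (by omega) hcl
      (by omega) (fun i hi => (hatt i hi).1) fun i hi => (hatt i hi).2

lemma elim (h : G.IsCritical ω x y) (hne : ∃ v, v ≠ x ∧ v ≠ y) : False := by
  obtain ⟨K, a, b, c, d, hs⟩ := h.exists_square hne
  have ha := hs.disjoint
  have hb := hs.rotate.disjoint
  have hc := hs.rotate.rotate.disjoint
  have hd := hs.rotate.rotate.rotate.disjoint
  have htri : ∀ u v z, u ∉ ({x, y} : Set V) → v ∉ ({x, y} : Set V) → G.Adj u v → G.Adj u z →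
      ¬ G.Adj v z := by
    intro u v z hu hv huv huz hvz
    apply h.noCycle.triangle huv hvz huz.symm
    rw [h.weight_left hu, h.weight_left hv, h.weight_right hu]
  have key : ∀ p q, p ∈ K → q ∈ K → p ≠ q → G.Adj a p → G.Adj b q → G.Adj c p →
      G.Adj d q → False := by
    intro p q hp hq hpq hap hbq hcp hdq
    refine h.noCycle.hexagon (a := a) (b := p) (c := c) (d := b) (e := q) (f := d) ?_
      ⟨hap, h.weight_left ha _⟩ ⟨hcp.symm, h.weight_right hc _⟩ ⟨hs.adj₂.symm, h.weight_left hc _⟩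
      ⟨hbq, h.weight_left hb _⟩ ⟨hdq.symm, h.weight_right hd _⟩ ⟨hs.adj₄, h.weight_left hd _⟩
    have hK : ∀ u ∉ K, u ≠ p ∧ u ≠ q := fun u hu => ⟨fun h => hu (h ▸ hp), fun h => hu (h ▸ hq)⟩
    have a1 := hK a hs.attached₁.1
    have a2 := hK b hs.attached₂.1
    have a3 := hK c hs.attached₃.1
    have a4 := hK d hs.attached₄.1
    simp only [List.nodup_cons, List.mem_cons, List.not_mem_nil, or_false, not_or, not_false_iff,
      List.nodup_nil, and_true]
    exact ⟨⟨a1.1, hs.ne₁, hs.adj₁.ne, a1.2, hs.adj₄.ne'⟩, ⟨a3.1.symm, a2.1.symm, hpq, a4.1.symm⟩,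
      ⟨hs.adj₂.ne', a3.2, hs.adj₃.ne⟩, ⟨a2.2, hs.ne₂⟩, a4.2.symm⟩
  have h₁ := h.adj_of_square hs
  have h₂ := h.adj_of_square hs.rotate
  have h₃ := h.adj_of_square hs.rotate.rotate
  rcases h₁ with ⟨h₁, h₁'⟩ | ⟨h₁, h₁'⟩
  · have hc' := (h₂.resolve_left fun h => htri a b x ha hb hs.adj₁ h₁ h.1).2
    have hd' := (h₃.resolve_right fun h => htri b c y hb hc hs.adj₂ h₁' h.1).2
    exact key x y hs.1 hs.2 h.adj.ne h₁ h₁' hc' hd'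
  · have hc' := (h₂.resolve_right fun h => htri a b y ha hb hs.adj₁ h₁ h.1).2
    have hd' := (h₃.resolve_left fun h => htri b c x hb hc hs.adj₂ h₁' h.1).2
    exact key y x hs.2 hs.1 h.adj.ne' h₁ h₁' hc' hd'

end IsCritical

theorem hasCycleBelow (n : ℕ) : HasCycleBelow.{u} n := by
  induction n with
  | zero => exact fun V _ h => absurd h (Nat.not_lt_zero _)
  | succ n ih =>
    intro V _ hn G x y ω hxy hω hpos h3 hne hG
    refine IsCritical.elim (G := G) (ω := ω) (x := x) (y := y)
      ⟨fun W _ hW => ih W (by omega), hG, hxy, hω, fun e => ?_, h3⟩ hne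
    by_cases he : e = s(x, y)
    · exact he ▸ hpos
    · exact (hω e he).ge

lemma hasThreeNeighbors_of_degree [DecidableEq V] {v : V} [Fintype (G.neighborSet v)]
    (h : 3 ≤ G.degree v) : G.HasThreeNeighbors v := by
  intro a b
  obtain ⟨c, hc, hc'⟩ := Finset.exists_mem_notMem_of_card_lt_card
    (s := {a, b}) (t := G.neighborFinset v) (Finset.card_le_two.trans_lt h)
  simp only [Finset.mem_insert, Finset.mem_singleton, not_or] at hc'
  exact ⟨c, by simpa using hc, hc'⟩

lemma HasThreeNeighbors.mono {H : SimpleGraph V} (hle : G ≤ H) {v : V}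
    (h : G.HasThreeNeighbors v) : H.HasThreeNeighbors v := fun a b =>
  (h a b).imp fun _ hc => ⟨hle hc.1, hc.2⟩

lemma not_noCycleModThree_of_adj [Finite V] {x y : V} (hxy : G.Adj x y)
    (h3 : ∀ v, v ≠ x → v ≠ y → G.HasThreeNeighbors v) (hne : ∃ v, v ≠ x ∧ v ≠ y) :
    ¬ G.NoCycleModThree fun _ => 1 :=
  hasCycleBelow _ V (Nat.lt_succ_self _) G x y _ hxy (fun _ _ => rfl) le_rfl h3 hne

/-- Joining an isolated vertex to another vertex creates no cycle. -/
lemma NoCycleModThree.sup_edge (hG : G.NoCycleModThree ω) {x y : V}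
    (hx : ∀ v, ¬ G.Adj x v) : (G ⊔ edge x y).NoCycleModThree ω := by
  intro v w hw hdvd
  have hx' : ∀ t, (G ⊔ edge x y).Adj x t → t = y := by
    intro t ht
    rw [sup_adj, edge_adj] at ht
    grind
  have hmem : s(x, y) ∉ w.edges := by
    intro he
    obtain ⟨p, hp, hpe, -⟩ := hw.exists_isPath (ω := ω) he
    have hne := (w.adj_of_mem_edges he).ne'
    cases hq : p.reverse with
    | nil => exact hne rfl
    | cons h q =>
      obtain rfl := hx' _ h
      apply hpe
      rw [← List.mem_reverse, ← Walk.edges_reverse, hq]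
      simp
  have hE : ∀ e ∈ w.edges, e ∈ G.edgeSet := by
    intro e he
    have h := w.edges_subset_edgeSet he
    induction e with
    | _ s t =>
      rw [mem_edgeSet, sup_adj, edge_adj] at h
      refine h.resolve_right fun h' => hmem ?_
      rcases h'.1 with ⟨rfl, rfl⟩ | ⟨rfl, rfl⟩
      · exact he
      · rwa [Sym2.eq_swap]
  refine hG v (w.transfer G hE) (hw.transfer hE) ?_
  simpa [Walk.weight] using hdvd

end SimpleGraph

theorem stmt_13 {V : Type*} [Fintype V] [DecidableEq V]
    (G : SimpleGraph V) [DecidableRel G.Adj] (hcard : 3 ≤ Fintype.card V)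
    (hσ : ∀ u v : V, u ≠ v → ¬G.Adj u v → 5 ≤ G.degree u + G.degree v) :
    ∃ (v : V) (w : G.Walk v v), w.IsCycle ∧ 3 ∣ w.length := by
  by_contra! hno
  have hG : G.NoCycleModThree fun _ => 1 := fun v w hw => by
    rw [SimpleGraph.Walk.weight_eq_length w fun _ _ => rfl]
    exact hno v w hw
  have h3 : ∀ v, ¬ G.degree v ≤ 2 → G.HasThreeNeighbors v := fun v hv =>
    SimpleGraph.hasThreeNeighbors_of_degree (by omega)
  have hlow : ∀ u v, u ≠ v → G.degree u ≤ 2 → G.degree v ≤ 2 → G.Adj u v := by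
    intro u v huv hu hv
    by_contra h
    have := hσ u v huv h
    omega
  have hthird : ∀ x y : V, ∃ v, v ≠ x ∧ v ≠ y := by
    intro x y
    obtain ⟨v, -, hv⟩ := Finset.exists_mem_notMem_of_card_lt_card
      (s := {x, y}) (t := Finset.univ) (Finset.card_le_two.trans_lt hcard)
    exact ⟨v, by simpa using hv⟩
  by_cases htwo : ∃ x y, x ≠ y ∧ G.degree x ≤ 2 ∧ G.degree y ≤ 2
  · obtain ⟨x, y, hxy, hx, hy⟩ := htwo
    refine SimpleGraph.not_noCycleModThree_of_adj (hlow x y hxy hx hy)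
      (fun v hvx hvy => h3 v fun hv => ?_) (hthird x y) hG
    exact hG.triangle (hlow x y hxy hx hy) (hlow y v hvy.symm hy hv) (hlow v x hvx hv hx)
      (dvd_refl 3)
  · push Not at htwo
    obtain ⟨x, hx⟩ : ∃ x, ∀ v, v ≠ x → G.HasThreeNeighbors v := by
      by_cases hone : ∃ x, G.degree x ≤ 2
      · obtain ⟨x, hx⟩ := hone
        exact ⟨x, fun v hv => h3 v (htwo x v hv.symm hx).not_ge⟩
      · push Not at hone
        obtain ⟨x⟩ : Nonempty V := Fintype.card_pos_iff.1 (by omega)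
        exact ⟨x, fun v _ => h3 v (hone v).not_ge⟩
    by_cases hadj : ∃ y, G.Adj x y
    · obtain ⟨y, hxy⟩ := hadj
      exact SimpleGraph.not_noCycleModThree_of_adj hxy (fun v hv _ => hx v hv) (hthird x y) hG
    · push Not at hadj
      obtain ⟨y, hy, -⟩ := hthird x x
      refine SimpleGraph.not_noCycleModThree_of_adj (G := G ⊔ SimpleGraph.edge x y) (x := x) (y := y) ?_
        (fun v hv _ => (hx v hv).mono le_sup_left) (hthird x y) (hG.sup_edge hadj)
      rw [SimpleGraph.sup_adj, SimpleGraph.edge_adj]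
      exact .inr ⟨.inl ⟨rfl, rfl⟩, hy.symm⟩
end
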